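/- arXiv:1905.11132 — 2 statements merged into one kernel-verified Lean document; each statement's English description precedes it below -/
import Mathlib

section
/- Let r=(r₁,…,rₙ) be an n-tuple of positive reals and let F : ℝⁿ → ℝⁿ be a continuous vector field that is r-homogeneous of degree κ ∈ (−∞,0). If the origin 0 ∈ ℝⁿ is asymptotically stable for ẋ = F(x), then the origin 0 ∈ ℝⁿ is small-time stable for ẋ = F(x). -/
open Set Filter

/-- Signed power: `⌊x⌉^a = sign(x) * |x|^a`. -/
noncomputable def spow (x a : ℝ) : ℝ := Real.sign x * |x| ^ a

/-- Dilation `Λ_r(l, x) = (l^{r₁} x₁, …, l^{rₙ} xₙ)`. -/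
noncomputable def dil {n : ℕ} (r : Fin n → ℝ) (l : ℝ) (x : Fin n → ℝ) : Fin n → ℝ :=
  fun i => l ^ r i * x i

/-- `x` is a solution of `ẋ = F(x)` on `[s, ∞)`. -/
def IsSolOn {E : Type*} [NormedAddCommGroup E] [NormedSpace ℝ E]
    (F : E → E) (x : ℝ → E) (s : ℝ) : Prop :=
  ∀ t ∈ Set.Ici s, HasDerivWithinAt x (F (x t)) (Set.Ici s) t

/-- The origin is (locally) asymptotically stable for `ẋ = F(x)`. -/
def AsympStable {E : Type*} [NormedAddCommGroup E] [NormedSpace ℝ E] (F : E → E) : Prop :=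
  (∀ ε > 0, ∃ η > 0, ∀ x : ℝ → E, IsSolOn F x 0 → ‖x 0‖ < η → ∀ t ≥ 0, ‖x t‖ < ε) ∧
  (∃ δ > 0, ∀ x : ℝ → E, IsSolOn F x 0 → ‖x 0‖ < δ →
    Filter.Tendsto x Filter.atTop (nhds 0))

/-- The origin is small-time stable for `ẋ = F(x)`. -/
def SmallTimeStable {E : Type*} [NormedAddCommGroup E] [NormedSpace ℝ E] (F : E → E) : Prop :=
  ∀ ε > 0, ∃ η > 0, ∀ x : ℝ → E, IsSolOn F x 0 → ‖x 0‖ < η →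
    x ε = 0 ∧ ∀ t ≥ 0, ‖x t‖ < ε

open Topology

section Limits

variable {E : Type*} [NormedAddCommGroup E] [NormedSpace ℝ E] {F : E → E}

/-- Time translation of a solution. -/
lemma IsSolOn.comp_add {x : ℝ → E} (hx : IsSolOn F x 0) {s : ℝ} (hs : 0 ≤ s) :
    IsSolOn F (fun t => x (s + t)) 0 := by
  intro t ht
  have ht0 : (0 : ℝ) ≤ t := ht
  have hinner : HasDerivWithinAt (fun u : ℝ => s + u) 1 (Ici 0) t :=
    (hasDerivWithinAt_id t _).const_add s
  have hmaps : MapsTo (fun u : ℝ => s + u) (Ici 0) (Ici 0) :=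
    fun u hu => add_nonneg hs hu
  have h := (hx (s + t) (add_nonneg hs ht0)).scomp t hinner hmaps
  rwa [one_smul] at h

/-- Uniformly bounded solutions are uniformly well approximated by their tangents. -/
lemma exists_forall_solution_tangent_le [ProperSpace E] (hF : Continuous F) (R : ℝ) {ε : ℝ}
    (hε : 0 < ε) : ∃ δ > 0, ∀ x : ℝ → E, IsSolOn F x 0 → (∀ t ≥ 0, ‖x t‖ ≤ R) →
      ∀ s ≥ 0, ∀ t ≥ 0, |s - t| < δ → ‖x s - x t - (s - t) • F (x t)‖ ≤ ε * ‖s - t‖ := by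
  have hK : IsCompact (Metric.closedBall (0 : E) R) := isCompact_closedBall 0 R
  obtain ⟨M, hM⟩ := hK.exists_bound_of_continuousOn hF.continuousOn
  obtain ⟨d, hd, hFd⟩ := Metric.uniformContinuousOn_iff.1
    (hK.uniformContinuousOn_of_continuous hF.continuousOn) ε hε
  have hM1 : 0 < |M| + 1 := by positivity
  refine ⟨d / (|M| + 1), by positivity, fun x hx hb s hs t ht hst => ?_⟩
  have hmem : ∀ u ≥ 0, x u ∈ Metric.closedBall (0 : E) R := fun u hu => by simpa using hb u hu
  have hlip : ∀ u ≥ 0, dist (x u) (x t) ≤ (|M| + 1) * |u - t| := fun u hu => by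
    rw [dist_eq_norm]
    exact (convex_Ici (0 : ℝ)).norm_image_sub_le_of_norm_hasDerivWithin_le hx
      (fun v hv => (hM _ (hmem v hv)).trans (by linarith [le_abs_self M])) ht hu
  have hclose : ∀ u ∈ Ici (0 : ℝ) ∩ Metric.ball t (d / (|M| + 1)),
      ‖F (x u) - F (x t)‖ ≤ ε := by
    rintro u ⟨hu, hut⟩
    rw [← dist_eq_norm]
    refine (hFd _ (hmem u hu) _ (hmem t ht) ((hlip u hu).trans_lt ?_)).le
    rw [Metric.mem_ball, Real.dist_eq, lt_div_iff₀ hM1] at hut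
    linarith
  have hderiv : ∀ u ∈ Ici (0 : ℝ) ∩ Metric.ball t (d / (|M| + 1)),
      HasDerivWithinAt (fun v => x v - v • F (x t)) (F (x u) - F (x t))
        (Ici (0 : ℝ) ∩ Metric.ball t (d / (|M| + 1))) u := by
    rintro u ⟨hu, hut⟩
    have h := ((hx u hu).mono inter_subset_left).sub
      ((hasDerivWithinAt_id u (Ici (0 : ℝ) ∩ Metric.ball t (d / (|M| + 1)))).smul_const (F (x t)))
    rw [one_smul] at h
    exact h
  have h := ((convex_Ici (0 : ℝ)).inter
    (convex_ball t (d / (|M| + 1)))).norm_image_sub_le_of_norm_hasDerivWithin_le hderiv hclose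
      ⟨ht, Metric.mem_ball_self (by positivity)⟩ ⟨hs, by simpa [Real.dist_eq] using hst⟩
  convert h using 2
  rw [sub_smul]
  abel

/-- Pointwise limits of uniformly bounded solutions along an ultrafilter are solutions. -/
lemma exists_limit_solution [ProperSpace E] (hF : Continuous F) {ι : Type*} (U : Ultrafilter ι)
    {x : ι → ℝ → E} (hx : ∀ k, IsSolOn F (x k) 0) {R : ℝ} (hb : ∀ k, ∀ t ≥ 0, ‖x k t‖ ≤ R) :
    ∃ y : ℝ → E, IsSolOn F y 0 ∧ ∀ t ≥ 0, Tendsto (fun k => x k t) U (𝓝 (y t)) := by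
  have hlim : ∀ t : ℝ, ∃ a : E, 0 ≤ t → Tendsto (fun k => x k t) U (𝓝 a) := by
    intro t
    by_cases ht : 0 ≤ t
    · obtain ⟨a, -, ha⟩ := (isCompact_closedBall (0 : E) R).ultrafilter_le_nhds
        (U.map fun k => x k t) (tendsto_principal.2 (Eventually.of_forall fun k => by
          simpa using hb k t ht))
      exact ⟨a, fun _ => ha⟩
    · exact ⟨0, fun h => absurd h ht⟩
  choose y hy using hlim
  refine ⟨y, fun t ht => ?_, fun t ht => hy t ht⟩
  rw [hasDerivWithinAt_iff_isLittleO, Asymptotics.isLittleO_iff]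
  intro ε hε
  obtain ⟨δ, hδ, hest⟩ := exists_forall_solution_tangent_le hF R hε
  filter_upwards [self_mem_nhdsWithin, mem_nhdsWithin_of_mem_nhds (Metric.ball_mem_nhds t hδ)]
    with s hs hst
  have hcont : Tendsto (fun k => ‖x k s - x k t - (s - t) • F (x k t)‖) U
      (𝓝 ‖y s - y t - (s - t) • F (y t)‖) :=
    (((hy s hs).sub (hy t ht)).sub
      (((hF.tendsto (y t)).comp (hy t ht)).const_smul (s - t))).norm
  exact le_of_tendsto hcont (Eventually.of_forall fun k =>
    hest (x k) (hx k) (hb k) s hs t ht (by simpa [Real.dist_eq] using hst))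

/-- Bounded solutions starting in a closed ball, all limits of which converge to the origin,
enter any ball around the origin within a uniform time. -/
lemma exists_uniform_entry_time [ProperSpace E] (hF : Continuous F) {c c' R : ℝ} (hc' : 0 < c')
    (hb : ∀ x : ℝ → E, IsSolOn F x 0 → ‖x 0‖ ≤ c → ∀ t ≥ 0, ‖x t‖ ≤ R)
    (hconv : ∀ x : ℝ → E, IsSolOn F x 0 → ‖x 0‖ ≤ c → Tendsto x atTop (𝓝 0)) :
    ∃ T ≥ 0, ∀ x : ℝ → E, IsSolOn F x 0 → ‖x 0‖ ≤ c → ∃ t ∈ Icc 0 T, ‖x t‖ < c' := by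
  by_contra! H
  have H' : ∀ k : ℕ, ∃ x : ℝ → E, IsSolOn F x 0 ∧ ‖x 0‖ ≤ c ∧
      ∀ t ∈ Icc (0 : ℝ) k, c' ≤ ‖x t‖ := fun k => by
    obtain ⟨x, hx⟩ := H k k.cast_nonneg
    exact ⟨x, hx⟩
  choose x hx hx0 hfar using H'
  obtain ⟨y, hy, hxy⟩ := exists_limit_solution hF (hyperfilter ℕ) hx
    (fun k => hb (x k) (hx k) (hx0 k))
  have hy0 : ‖y 0‖ ≤ c := le_of_tendsto (hxy 0 le_rfl).norm (Eventually.of_forall hx0)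
  have hyfar : ∀ t ≥ 0, c' ≤ ‖y t‖ := fun t ht => by
    refine ge_of_tendsto (hxy t ht).norm ?_
    have hev : ∀ᶠ k : ℕ in atTop, c' ≤ ‖x k t‖ := by
      filter_upwards [eventually_ge_atTop ⌈t⌉₊] with k hk
      exact hfar k t ⟨ht, Nat.ceil_le.1 hk⟩
    exact Nat.hyperfilter_le_atTop hev
  have h0 := (hconv y hy hy0).norm
  rw [norm_zero] at h0
  exact hc'.not_ge (ge_of_tendsto h0 ((eventually_ge_atTop 0).mono hyfar))

end Limits

section Dilation

variable {n : ℕ} {r : Fin n → ℝ}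

lemma dil_mul {a b : ℝ} (ha : 0 ≤ a) (hb : 0 ≤ b) (x : Fin n → ℝ) :
    dil r (a * b) x = dil r a (dil r b x) := by
  ext i
  simp only [dil, Real.mul_rpow ha hb, mul_assoc]

lemma dil_one (x : Fin n → ℝ) : dil r 1 x = x := by
  ext i
  simp [dil]

lemma exists_norm_dil_le (r : Fin n → ℝ) (l : ℝ) {c : ℝ} (hc : 0 < c) :
    ∃ η > 0, ∀ x, ‖x‖ < η → ‖dil r l x‖ ≤ c := by
  have hcont : Continuous (dil r l) := by unfold dil; fun_prop
  have h0 : dil r l 0 = 0 := by ext i; simp [dil]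
  obtain ⟨η, hη, h⟩ := Metric.continuousAt_iff.1 (hcont.continuousAt (x := 0)) c hc
  refine ⟨η, hη, fun x hx => ?_⟩
  have := h (x := x) (by simpa using hx)
  rw [h0, dist_zero_right] at this
  exact this.le

/-- Dilations combined with time rescaling preserve solutions of homogeneous equations. -/
lemma IsSolOn.dil {κ : ℝ} {F : (Fin n → ℝ) → (Fin n → ℝ)}
    (hhom : ∀ i, ∀ lam > (0 : ℝ), ∀ x, F (dil r lam x) i = lam ^ (κ + r i) * F x i)
    {x : ℝ → Fin n → ℝ} (hx : IsSolOn F x 0) {l : ℝ} (hl : 0 < l) :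
    IsSolOn F (fun t => _root_.dil r l (x (l ^ κ * t))) 0 := by
  intro t ht
  have hlκ : 0 < l ^ κ := Real.rpow_pos_of_pos hl κ
  have hinner : HasDerivWithinAt (fun u : ℝ => l ^ κ * u) (l ^ κ) (Ici 0) t := by
    simpa using (hasDerivWithinAt_id t (Ici (0 : ℝ))).const_mul (l ^ κ)
  have hmaps : MapsTo (fun u : ℝ => l ^ κ * u) (Ici 0) (Ici 0) :=
    fun u hu => mul_nonneg hlκ.le hu
  have h := (hx _ (hmaps ht)).scomp t hinner hmaps
  rw [hasDerivWithinAt_pi] at h ⊢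
  intro i
  have hi := (h i).const_mul (l ^ r i)
  rw [Pi.smul_apply, smul_eq_mul, ← mul_assoc, mul_comm (l ^ r i), ← Real.rpow_add hl] at hi
  rw [hhom i l hl]
  exact hi

lemma eq_zero_of_forall_norm_dil_two_pow_le (hr : ∀ i, 0 < r i) {x : Fin n → ℝ} {R : ℝ}
    (h : ∀ k : ℕ, ‖dil r (2 ^ k) x‖ ≤ R) : x = 0 := by
  ext i
  by_contra hxi
  have hxi' : 0 < |x i| := abs_pos.2 hxi
  have hgrow : Tendsto (fun k : ℕ => ((2 : ℝ) ^ k) ^ r i * |x i|) atTop atTop :=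
    ((tendsto_rpow_atTop (hr i)).comp
      (tendsto_pow_atTop_atTop_of_one_lt one_lt_two)).atTop_mul_const hxi'
  obtain ⟨k, hk⟩ := (hgrow.eventually_gt_atTop R).exists
  have hle := (norm_le_pi_norm (dil r (2 ^ k) x) i).trans (h k)
  rw [dil, norm_mul, Real.norm_eq_abs, Real.norm_eq_abs,
    abs_of_pos (Real.rpow_pos_of_pos (by positivity) _)] at hle
  exact hk.not_ge hle

end Dilation

/-- For a homogeneous vector field of negative degree, solutions starting in a ball which stay
bounded and contract uniformly vanish after a uniform time. -/
lemma exists_uniform_extinction_time {n : ℕ} {r : Fin n → ℝ} (hr : ∀ i, 0 < r i) {κ : ℝ}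
    (hκ : κ < 0) {F : (Fin n → ℝ) → (Fin n → ℝ)}
    (hhom : ∀ i, ∀ lam > (0 : ℝ), ∀ x, F (dil r lam x) i = lam ^ (κ + r i) * F x i)
    {c R T : ℝ} (hT : 0 ≤ T)
    (hb : ∀ x, IsSolOn F x 0 → ‖x 0‖ ≤ c → ∀ t ≥ 0, ‖x t‖ ≤ R)
    (hentry : ∀ x, IsSolOn F x 0 → ‖x 0‖ ≤ c → ∃ t ∈ Icc 0 T, ‖dil r 2 (x t)‖ ≤ c) :
    ∃ T' : ℝ, ∀ x, IsSolOn F x 0 → ‖x 0‖ ≤ c → ∀ t ≥ T', x t = 0 := by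
  have hq0 : (0 : ℝ) ≤ 2 ^ κ := by positivity
  have hq1 : (2 : ℝ) ^ κ < 1 := Real.rpow_lt_one_of_one_lt_of_neg one_lt_two hκ
  have hpow : ∀ k : ℕ, ((2 : ℝ) ^ k) ^ κ = (2 ^ κ) ^ k := fun k =>
    Real.rpow_pow_comm zero_le_two κ k |>.symm
  refine ⟨T * (1 - 2 ^ κ)⁻¹, fun x hx hx0 t ht => ?_⟩
  have hstep : ∀ k : ℕ, ∃ s ∈ Icc 0 (T * ∑ j ∈ Finset.range k, ((2 : ℝ) ^ κ) ^ j),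
      ‖dil r (2 ^ k) (x s)‖ ≤ c := by
    intro k
    induction k with
    | zero => exact ⟨0, by simp, by simpa [dil_one] using hx0⟩
    | succ k ih =>
      obtain ⟨s, ⟨hs0, hs⟩, hsc⟩ := ih
      obtain ⟨u, ⟨hu0, hu⟩, huc⟩ := hentry _
        ((hx.comp_add hs0).dil hhom (l := 2 ^ k) (by positivity)) (by simpa using hsc)
      rw [hpow, ← dil_mul zero_le_two (by positivity), ← pow_succ'] at huc
      refine ⟨s + (2 ^ κ) ^ k * u, ⟨by positivity, ?_⟩, huc⟩
      rw [Finset.sum_range_succ, mul_add, mul_comm T ((2 ^ κ) ^ k)]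
      gcongr
  refine eq_zero_of_forall_norm_dil_two_pow_le hr (R := R) fun k => ?_
  obtain ⟨s, ⟨hs0, hs⟩, hsc⟩ := hstep k
  have hst : s ≤ t := by
    refine hs.trans (le_trans ?_ ht)
    gcongr
    rw [← tsum_geometric_of_lt_one hq0 hq1]
    exact (summable_geometric_of_lt_one hq0 hq1).sum_le_tsum _ fun j _ => by positivity
  have hpos : 0 < ((2 : ℝ) ^ k) ^ κ := by positivity
  have h := hb _ ((hx.comp_add hs0).dil hhom (l := 2 ^ k) (by positivity)) (by simpa using hsc)
    ((((2 : ℝ) ^ k) ^ κ)⁻¹ * (t - s)) (mul_nonneg (by positivity) (sub_nonneg.2 hst))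
  rwa [mul_inv_cancel_left₀ hpos.ne', add_sub_cancel] at h

/-- A continuous `r`-homogeneous vector field of negative degree whose origin is
asymptotically stable is small-time stable. -/
theorem stmt2 {n : ℕ} (r : Fin n → ℝ) (hr : ∀ i, 0 < r i) (κ : ℝ) (hκ : κ < 0)
    (F : (Fin n → ℝ) → (Fin n → ℝ)) (hF : Continuous F)
    (hhom : ∀ i, ∀ lam > (0:ℝ), ∀ x, F (dil r lam x) i = lam ^ (κ + r i) * F x i)
    (hstab : AsympStable F) :
    SmallTimeStable F := by
  obtain ⟨hstable, δ, hδ, hattr⟩ := hstab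
  obtain ⟨η₁, hη₁, hη₁b⟩ := hstable 1 one_pos
  obtain ⟨c, hc, hcmin⟩ := exists_between (lt_min hη₁ hδ)
  rw [lt_min_iff] at hcmin
  have hb : ∀ x, IsSolOn F x 0 → ‖x 0‖ ≤ c → ∀ t ≥ 0, ‖x t‖ ≤ 1 := fun x hx hx0 t ht =>
    (hη₁b x hx (hx0.trans_lt hcmin.1) t ht).le
  obtain ⟨c', hc', hdil⟩ := exists_norm_dil_le r 2 hc
  obtain ⟨T, hT, hentry⟩ := exists_uniform_entry_time hF hc' hb
    fun x hx hx0 => hattr x hx (hx0.trans_lt hcmin.2)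
  obtain ⟨T', hT'⟩ := exists_uniform_extinction_time hr hκ hhom hT hb fun x hx hx0 =>
    let ⟨t, ht, htc⟩ := hentry x hx hx0
    ⟨t, ht, hdil _ htc⟩
  intro ε hε
  obtain ⟨l, hlT, hl⟩ : ∃ l : ℝ, T' ≤ l ^ (-κ) * ε ∧ 0 < l :=
    ((((tendsto_rpow_atTop (neg_pos.2 hκ)).atTop_mul_const hε).eventually_ge_atTop T').and
      (eventually_gt_atTop 0)).exists
  obtain ⟨η₂, hη₂, hη₂c⟩ := exists_norm_dil_le r l hc
  obtain ⟨η₃, hη₃, hη₃b⟩ := hstable ε hε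
  refine ⟨min η₂ η₃, lt_min hη₂ hη₃, fun x hx hx0 => ?_⟩
  rw [lt_min_iff] at hx0
  refine ⟨?_, hη₃b x hx hx0.2⟩
  have h := hT' _ (hx.dil hhom hl) (by simpa using hη₂c _ hx0.1) _ hlT
  rw [← mul_assoc, ← Real.rpow_add hl, add_neg_cancel, Real.rpow_zero, one_mul] at h
  ext i
  have hi := congrFun h i
  exact (mul_eq_zero.1 hi).resolve_left (Real.rpow_pos_of_pos hl _).ne'
end

section
/- Consider the cascaded control system ẋ = f(x,y), ẏ = v with state (x,y) ∈ ℝⁿ × ℝ and control v ∈ ℝ. Let r=(r₁,…,rₙ,r_{n+1}) be positive reals, write r̄=(r₁,…,rₙ), and let f=(f₁,…,fₙ) be continuous with f_i(Λ_{r̄}(λ,x), λ^{r_{n+1}}y) = λ^{r_i+κ} f_i(x,y) for all x ∈ ℝⁿ, y ∈ ℝ, λ>0 and all i ∈ {1,…,n}. Assume κ ∈ ℝ satisfies κ + r_i > 0 for all i ∈ {1,…,n,n+1}, and that there exist a continuous feedback law ȳ : ℝⁿ → ℝ and l ∈ (0,+∞) such that: l+1 > r_i/r_{n+1} for all i ∈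 {1,…,n}; ȳ is r̄-homogeneous of degree r_{n+1}; 0 ∈ ℝⁿ is asymptotically stable for ẋ = f(x,ȳ(x)); and the function x ↦ ⌊ȳ(x)⌉^l is of class C¹. Then there exists k₀ > 0 such that for every gain k > k₀, the control law v(x,y) = −k ⌊⌊y⌉^l − ⌊ȳ(x)⌉^l⌉^{(κ+r_{n+1})/(l r_{n+1})} makes 0 ∈ ℝ^{n+1} asymptotically stable for the closed-loop cascaded system. Moreover, if κ < 0, then 0 ∈ ℝ^{n+1} is small-time stable for the closed-loop cascaded system. -/
open Set Filter

open Topology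

theorem spow_eq_max {a : ℝ} (ha : 0 < a) (x : ℝ) :
    spow x a = max x 0 ^ a - max (-x) 0 ^ a := by
  unfold spow
  rcases lt_trichotomy x 0 with h | h | h
  · rw [Real.sign_of_neg h, abs_of_neg h, max_eq_right h.le, max_eq_left (by linarith),
      Real.zero_rpow ha.ne']
    ring
  · simp [h]
  · rw [Real.sign_of_pos h, abs_of_pos h, max_eq_left h.le, max_eq_right (by linarith),
      Real.zero_rpow ha.ne']
    ring

theorem continuous_spow {a : ℝ} (ha : 0 < a) : Continuous fun x => spow x a := by
  simp only [spow_eq_max ha]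
  exact ((continuous_id.max continuous_const).rpow_const fun _ => Or.inr ha.le).sub
    ((continuous_neg.max continuous_const).rpow_const fun _ => Or.inr ha.le)

theorem strictMono_spow {a : ℝ} (ha : 0 < a) : StrictMono fun x => spow x a := by
  intro x y h
  simp only [spow_eq_max ha]
  rcases lt_or_ge 0 y with hy | hy
  · have h1 : max x 0 ^ a < max y 0 ^ a :=
      Real.rpow_lt_rpow (le_max_right _ _) (by rw [max_eq_left hy.le]; exact max_lt h hy) ha
    have h2 : max (-y) 0 ^ a ≤ max (-x) 0 ^ a :=
      Real.rpow_le_rpow (le_max_right _ _) (max_le_max_right _ (by linarith)) ha.le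
    linarith
  · have h1 : max x 0 ^ a ≤ max y 0 ^ a :=
      Real.rpow_le_rpow (le_max_right _ _) (max_le_max_right _ h.le) ha.le
    have h2 : max (-y) 0 ^ a < max (-x) 0 ^ a := by
      refine Real.rpow_lt_rpow (le_max_right _ _) ?_ ha
      rw [max_eq_left (by linarith : 0 ≤ -y)]
      exact lt_max_of_lt_left (by linarith)
    linarith

theorem spow_zero_left (a : ℝ) : spow 0 a = 0 := by simp [spow]

theorem spow_mul {c : ℝ} (hc : 0 < c) (x a : ℝ) : spow (c * x) a = c ^ a * spow x a := by
  unfold spow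
  have hs : Real.sign (c * x) = Real.sign x := by
    rcases lt_trichotomy x 0 with h | h | h
    · rw [Real.sign_of_neg h, Real.sign_of_neg (mul_neg_of_pos_of_neg hc h)]
    · simp [h]
    · rw [Real.sign_of_pos h, Real.sign_of_pos (mul_pos hc h)]
  rw [hs, abs_mul, abs_of_pos hc, Real.mul_rpow hc.le (abs_nonneg x)]
  ring

theorem exists_norm_le_of_norm_le {E G : Type*} [NormedAddCommGroup E] [ProperSpace E]
    [SeminormedAddCommGroup G] {g : E → G} (hg : Continuous g) (R : ℝ) :
    ∃ L > 0, ∀ p, ‖p‖ ≤ R → ‖g p‖ ≤ L := by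
  obtain ⟨L, hL⟩ := (isCompact_closedBall (0 : E) R).exists_bound_of_continuousOn hg.continuousOn
  exact ⟨max L 1, by positivity, fun p hp => (hL p (by simpa using hp)).trans (le_max_left _ _)⟩

section Limits

variable {E : Type*} [NormedAddCommGroup E] [NormedSpace ℝ E]

/-- The first component of `z = (x, y)` solves `ẋ = f(x, y)` on `[0, ∞)`. -/
def SolvesAlong (f : E → ℝ → E) (z : ℝ → E × ℝ) : Prop :=
  ∀ t ∈ Ici (0 : ℝ), HasDerivWithinAt (fun s => (z s).1) (f (z t).1 (z t).2) (Ici 0) t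

/-- Along the filter `U`, the curves `z n` are uniformly bounded on each `[0, T]`. -/
def LocallyBoundedAlong (U : Filter ℕ) (z : ℕ → ℝ → E × ℝ) : Prop :=
  ∀ T : ℝ, ∃ R : ℝ, ∀ᶠ n in U, ∀ t ∈ Icc 0 T, ‖z n t‖ ≤ R

/-- Along the filter `U`, the second components of `z n` approach `ybar` of the first components,
locally uniformly on `(0, ∞)`. -/
def TracksAlong (U : Filter ℕ) (ybar : E → ℝ) (z : ℕ → ℝ → E × ℝ) : Prop :=
  ∀ t > (0 : ℝ), Tendsto (fun p : ℕ × ℝ => (z p.1 p.2).2 - ybar (z p.1 p.2).1)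
    (U ×ˢ 𝓝 t) (𝓝 0)

theorem SolvesAlong.norm_sub_le {f : E → ℝ → E} {z : ℝ → E × ℝ} (hz : SolvesAlong f z)
    {T L s t : ℝ} (hL : ∀ t ∈ Icc 0 T, ‖f (z t).1 (z t).2‖ ≤ L)
    (hs : s ∈ Icc 0 T) (ht : t ∈ Icc 0 T) : ‖(z s).1 - (z t).1‖ ≤ L * |s - t| :=
  Convex.norm_image_sub_le_of_norm_hasDerivWithin_le (f := fun s => (z s).1)
    (fun u hu => (hz u hu.1).mono fun _ h => h.1) hL (convex_Icc 0 T) ht hs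

theorem SolvesAlong.exists_limit [ProperSpace E] {f : E → ℝ → E}
    (hf : Continuous fun p : E × ℝ => f p.1 p.2) {ybar : E → ℝ} (hy : Continuous ybar)
    {U : Ultrafilter ℕ} {z : ℕ → ℝ → E × ℝ} (hz : ∀ n, SolvesAlong f (z n))
    (hb : LocallyBoundedAlong U z) (htr : TracksAlong U ybar z) :
    ∃ w : ℝ → E, IsSolOn (fun x => f x (ybar x)) w 0 ∧
      Tendsto (fun n => (z n 0).1) U (𝓝 (w 0)) ∧
      ∀ t > 0, Tendsto (fun p : ℕ × ℝ => z p.1 p.2) (U ×ˢ 𝓝 t) (𝓝 (w t, ybar (w t))) := by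
  have hex : ∀ t : ℝ, ∃ w : E, 0 ≤ t → Tendsto (fun n => (z n t).1) U (𝓝 w) := by
    intro t
    by_cases ht : 0 ≤ t
    · obtain ⟨R, hR⟩ := hb t
      have hle : (U.map fun n => (z n t).1 : Filter E) ≤ 𝓟 (Metric.closedBall 0 R) := by
        rw [le_principal_iff, Ultrafilter.coe_map, mem_map]
        filter_upwards [hR] with n hn
        simpa using (norm_fst_le _).trans (hn t ⟨ht, le_rfl⟩)
      obtain ⟨w, -, hw⟩ := (isCompact_closedBall (0 : E) R).ultrafilter_le_nhds _ hle
      exact ⟨w, fun _ => hw⟩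
    · exact ⟨0, fun h => absurd h ht⟩
  choose w hw using hex
  have hLip : ∀ T : ℝ, ∃ L > 0, ∀ᶠ n in U, ∀ s ∈ Icc 0 T, ∀ t ∈ Icc 0 T,
      ‖(z n s).1 - (z n t).1‖ ≤ L * |s - t| := by
    intro T
    obtain ⟨R, hR⟩ := hb T
    obtain ⟨L, hL0, hL⟩ := exists_norm_le_of_norm_le hf R
    refine ⟨L, hL0, ?_⟩
    filter_upwards [hR] with n hn s hs t ht
    exact (hz n).norm_sub_le (fun u hu => hL _ (hn u hu)) hs ht
  have hfst : ∀ t > 0, Tendsto (fun p : ℕ × ℝ => (z p.1 p.2).1) (U ×ˢ 𝓝 t) (𝓝 (w t)) := by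
    intro t ht
    obtain ⟨L, hL0, hL⟩ := hLip (t + 1)
    have h1 : Tendsto (fun p : ℕ × ℝ => (z p.1 p.2).1 - (z p.1 t).1) (U ×ˢ 𝓝 t) (𝓝 0) := by
      have hg : Tendsto (fun p : ℕ × ℝ => L * |p.2 - t|) ((U : Filter ℕ) ×ˢ 𝓝 t) (𝓝 0) := by
        have : Tendsto (fun s : ℝ => L * |s - t|) (𝓝 t) (𝓝 (L * |t - t|)) := by
          apply Continuous.tendsto; fun_prop
        simp only [sub_self, abs_zero, mul_zero] at this
        exact this.comp tendsto_snd
      refine squeeze_zero_norm' ?_ hg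
      filter_upwards [hL.prod_mk (Icc_mem_nhds ht (by linarith : t < t + 1))] with p hp
      exact hp.1 _ hp.2 _ ⟨ht.le, by linarith⟩
    simpa using h1.add ((hw t ht.le).comp tendsto_fst)
  have hpair : ∀ t > 0, Tendsto (fun p : ℕ × ℝ => z p.1 p.2) (U ×ˢ 𝓝 t)
      (𝓝 (w t, ybar (w t))) := by
    intro t ht
    have h2 := (htr t ht).add ((hy.tendsto (w t)).comp (hfst t ht))
    simp only [Function.comp_def, sub_add_cancel, zero_add] at h2
    exact (hfst t ht).prodMk_nhds h2
  have hder : ∀ t > 0, HasDerivAt w (f (w t) (ybar (w t))) t := by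
    intro t ht
    rw [hasDerivAt_iff_isLittleO, Asymptotics.isLittleO_iff]
    intro ε hε
    have h1 := ((hf.tendsto (w t, ybar (w t))).comp (hpair t ht)).eventually
      (Metric.closedBall_mem_nhds _ hε)
    obtain ⟨pa, hpa, pb, hpb, hab⟩ := eventually_prod_iff.1 h1
    obtain ⟨δ, hδ, hball⟩ := Metric.eventually_nhds_iff_ball.1
      (hpb.and (lt_mem_nhds ht))
    filter_upwards [Metric.ball_mem_nhds t hδ] with s hs
    have hs0 : 0 < s := (hball s hs).2
    have hlim : Tendsto (fun n => (z n s).1 - (z n t).1 - (s - t) • f (w t) (ybar (w t))) U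
        (𝓝 (w s - w t - (s - t) • f (w t) (ybar (w t)))) :=
      ((hw s hs0.le).sub (hw t ht.le)).sub_const _
    refine le_of_tendsto hlim.norm ?_
    filter_upwards [hpa] with n hn
    have hd : ∀ u ∈ Metric.ball t δ, HasDerivWithinAt
        (fun u => (z n u).1 - u • f (w t) (ybar (w t)))
        (f (z n u).1 (z n u).2 - (1 : ℝ) • f (w t) (ybar (w t))) (Metric.ball t δ) u := by
      intro u hu
      exact ((hz n u (hball u hu).2.le).mono fun v hv => (hball v hv).2.le).sub
        ((hasDerivWithinAt_id u _).smul_const _)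
    have := Convex.norm_image_sub_le_of_norm_hasDerivWithin_le hd (C := ε) (fun u hu => by
      have := hab hn (hball u hu).1
      rw [one_smul]
      simpa [dist_eq_norm] using this) (convex_ball t δ) (Metric.mem_ball_self hδ) hs
    have hrw : (z n s).1 - (z n t).1 - (s - t) • f (w t) (ybar (w t)) =
        (z n s).1 - s • f (w t) (ybar (w t)) - ((z n t).1 - t • f (w t) (ybar (w t))) := by
      rw [sub_smul]; abel
    rw [hrw]
    exact this
  have hcont : ContinuousWithinAt w (Ioi 0) 0 := by
    obtain ⟨L, hL0, hL⟩ := hLip 1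
    have hbd : ∀ s ∈ Ioc (0 : ℝ) 1, ‖w s - w 0‖ ≤ L * |s - 0| := by
      intro s hs
      refine le_of_tendsto ((hw s hs.1.le).sub (hw 0 le_rfl)).norm ?_
      filter_upwards [hL] with n hn
      exact hn s ⟨hs.1.le, hs.2⟩ 0 ⟨le_rfl, zero_le_one⟩
    have hg : Tendsto (fun s : ℝ => L * |s - 0|) (𝓝[>] 0) (𝓝 0) := by
      have : Tendsto (fun s : ℝ => L * |s - 0|) (𝓝 0) (𝓝 (L * |0 - 0|)) := by
        apply Continuous.tendsto; fun_prop
      simp only [sub_self, abs_zero, mul_zero] at this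
      exact this.mono_left nhdsWithin_le_nhds
    refine tendsto_iff_norm_sub_tendsto_zero.2 (squeeze_zero' (Eventually.of_forall fun _ =>
      norm_nonneg _) ?_ hg)
    filter_upwards [Ioc_mem_nhdsGT (zero_lt_one (α := ℝ))] with s hs using hbd s hs
  refine ⟨w, ?_, hw 0 le_rfl, hpair⟩
  intro t ht
  rcases (mem_Ici.1 ht).eq_or_lt with rfl | ht
  · refine hasDerivWithinAt_Ici_of_tendsto_deriv (s := Ioi 0)
      (fun s hs => (hder s hs).differentiableAt.differentiableWithinAt) hcont
      self_mem_nhdsWithin ?_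
    have hc : Continuous fun x => f x (ybar x) := hf.comp (continuous_id.prodMk hy)
    refine ((hc.tendsto (w 0)).comp hcont).congr' ?_
    filter_upwards [self_mem_nhdsWithin] with s hs using (hder s hs).deriv.symm
  · exact (hder t ht).hasDerivWithinAt

/-- A scalar function that decreases at rate at least `c` above the level `b` is below `b`
after a sufficiently long time. -/
theorem le_of_deriv_le_neg_above {y y' : ℝ → ℝ} {α β b c R : ℝ} (hαβ : α < β)
    (hy : ContinuousOn y (Icc α β)) (hy' : ∀ u ∈ Ico α β, HasDerivWithinAt y (y' u) (Ici u) u)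
    (hc : 0 < c) (hd : ∀ u ∈ Ico α β, b ≤ y u → y' u ≤ -c) (hR : y α ≤ R)
    (hRb : R - c * (β - α) < b) : y β ≤ b := by
  set m := max ((R - b) / (β - α)) 0 with hm
  have hβα : 0 < β - α := sub_pos.2 hαβ
  have hmc : m < c := max_lt (by rw [div_lt_iff₀ hβα]; linarith) hc
  have hmR : R - b ≤ m * (β - α) := by
    rw [← div_le_iff₀ hβα]; exact le_max_left _ _
  have hm0 : 0 ≤ m := le_max_right _ _
  have key := image_le_of_deriv_right_lt_deriv_boundary (B := fun u => b + m * (β - u))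
    (B' := fun _ => -m) hy hy' (by show y α ≤ b + m * (β - α); linarith)
    (fun u => by
      have := (((hasDerivAt_id u).const_sub β).const_mul m).const_add b
      simpa using this)
    (fun u hu h => by
      have h0 : 0 ≤ m * (β - u) := mul_nonneg hm0 (sub_nonneg.2 hu.2.le)
      have := hd u hu (by rw [h]; linarith)
      show y' u < -m
      linarith) (right_mem_Icc.2 hαβ.le)
  simpa using key

theorem eventually_sub_le_of_highGain [ProperSpace E] {f : E → ℝ → E}
    (hf : Continuous fun p : E × ℝ => f p.1 p.2) {ybar : E → ℝ} (hy : Continuous ybar)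
    {σ : E → ℝ → ℝ} (hσ : Continuous fun p : E × ℝ => σ p.1 p.2)
    (hpos : ∀ x y, ybar x < y → 0 < σ x y)
    {U : Filter ℕ} {z : ℕ → ℝ → E × ℝ} (hz : ∀ n, SolvesAlong f (z n))
    {k : ℕ → ℝ} (hk : Tendsto k U atTop)
    (hzy : ∀ n, ∀ t ∈ Ici (0 : ℝ), HasDerivWithinAt (fun s => (z n s).2)
      (-k n * σ (z n t).1 (z n t).2) (Ici 0) t)
    (hb : LocallyBoundedAlong U z) {t δ : ℝ} (ht : 0 < t) (hδ : 0 < δ) :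
    ∀ᶠ p : ℕ × ℝ in U ×ˢ 𝓝 t, (z p.1 p.2).2 - ybar (z p.1 p.2).1 < δ := by
  obtain ⟨R, hR⟩ := hb (t + 1)
  obtain ⟨L, hL0, hL⟩ := exists_norm_le_of_norm_le hf R
  obtain ⟨Y, hY0, hY⟩ := exists_norm_le_of_norm_le hy R
  obtain ⟨ν, hν0, hν⟩ : ∃ ν > 0, ∀ p : E × ℝ, ‖p‖ ≤ R → δ / 4 ≤ p.2 - ybar p.1 →
      ν ≤ σ p.1 p.2 := by
    have hK : IsCompact (Metric.closedBall (0 : E × ℝ) R ∩ {p | δ / 4 ≤ p.2 - ybar p.1}) :=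
      (isCompact_closedBall _ _).inter_right (isClosed_le continuous_const (by fun_prop))
    rcases (Metric.closedBall (0 : E × ℝ) R ∩ {p | δ / 4 ≤ p.2 - ybar p.1}).eq_empty_or_nonempty
      with h | h
    · refine ⟨1, one_pos, fun p hp hp' => ?_⟩
      have : p ∈ (∅ : Set (E × ℝ)) := h ▸ ⟨by simpa using hp, hp'⟩
      exact this.elim
    · obtain ⟨q, hq, hmin⟩ := hK.exists_isMinOn h hσ.continuousOn
      refine ⟨_, hpos q.1 q.2 ?_, fun p hp hp' => hmin ⟨by simpa using hp, hp'⟩⟩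
      have : δ / 4 ≤ q.2 - ybar q.1 := hq.2
      linarith
  obtain ⟨ρ, hρ, hunif⟩ := Metric.uniformContinuousOn_iff.1
    ((isCompact_closedBall (0 : E) R).uniformContinuousOn_of_continuous hy.continuousOn)
    (δ / 4) (by linarith)
  set h := min (t / 2) (ρ / (2 * L)) with hh
  have hh0 : 0 < h := by positivity
  have hLh : L * h < ρ := by
    have h1 : L * h ≤ L * (ρ / (2 * L)) := mul_le_mul_of_nonneg_left (min_le_right _ _) hL0.le
    have h2 : L * (ρ / (2 * L)) = ρ / 2 := by field_simp
    linarith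
  filter_upwards [(hR.and (hk.eventually_gt_atTop ((R + Y + 1) / (ν * h) + 1))).prod_mk
    (Ioo_mem_nhds (by linarith : t / 2 < t) (by linarith : t < t + 1))] with p hp
  obtain ⟨⟨hbd, hkn⟩, hs⟩ := hp
  obtain ⟨n, s⟩ := p
  simp only at hbd hkn hs ⊢
  have hR0 : 0 ≤ R := (norm_nonneg _).trans (hbd t ⟨ht.le, by linarith⟩)
  have hk0 : 0 < k n := lt_trans (by positivity) hkn
  have hsh : 0 ≤ s - h := by have := min_le_left (t / 2) (ρ / (2 * L)); linarith [hs.1]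
  have hsI : s ∈ Icc 0 (t + 1) := ⟨by linarith, hs.2.le⟩
  have huI : ∀ u ∈ Icc (s - h) s, u ∈ Icc 0 (t + 1) := fun u hu =>
    ⟨hsh.trans hu.1, hu.2.trans hs.2.le⟩
  have hmem : ∀ u ∈ Icc 0 (t + 1), (z n u).1 ∈ Metric.closedBall (0 : E) R := fun u hu => by
    simpa using (norm_fst_le _).trans (hbd u hu)
  have hbar : ∀ u ∈ Icc (s - h) s, |ybar (z n u).1 - ybar (z n s).1| < δ / 4 := by
    intro u hu
    refine hunif _ (hmem u (huI u hu)) _ (hmem s hsI) ?_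
    rw [dist_eq_norm]
    refine ((hz n).norm_sub_le (fun v hv => hL _ (hbd v hv)) (huI u hu) hsI).trans_lt
      (lt_of_le_of_lt (mul_le_mul_of_nonneg_left ?_ hL0.le) hLh)
    rw [abs_le]; constructor <;> linarith [hu.1, hu.2]
  have key : (z n s).2 ≤ ybar (z n s).1 + δ / 2 := by
    refine le_of_deriv_le_neg_above (y := fun u => (z n u).2) (α := s - h) (c := k n * ν) (R := R)
      (y' := fun u => -k n * σ (z n u).1 (z n u).2) (by linarith) ?_ ?_ (by positivity) ?_ ?_ ?_
    · exact fun u hu => ((hzy n u (huI u hu).1).mono fun v hv => (huI v hv).1).continuousWithinAt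
    · exact fun u hu => (hzy n u (hsh.trans hu.1)).mono fun v hv =>
        (hsh.trans hu.1).trans hv
    · intro u hu hbu
      have h1 := hbar u ⟨hu.1, hu.2.le⟩
      rw [abs_lt] at h1
      have h2 := hν (z n u) (hbd u (huI u ⟨hu.1, hu.2.le⟩)) (by linarith [h1.2])
      nlinarith
    · exact (le_abs_self _).trans ((norm_snd_le _).trans
        (hbd _ (huI _ ⟨le_rfl, by linarith⟩)))
    · have h1 : -Y ≤ ybar (z n s).1 := (abs_le.1 (hY _ (by simpa using hmem s hsI))).1
      have h2 : R + Y + 1 < k n * (ν * h) := by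
        rw [← div_lt_iff₀ (by positivity)]; linarith
      have h3 : k n * ν * (s - (s - h)) = k n * (ν * h) := by ring
      rw [h3]; linarith
  linarith

/-- In the high-gain limit `k → ∞`, the second component tracks `ybar`. -/
theorem tracksAlong_of_highGain [ProperSpace E] {f : E → ℝ → E}
    (hf : Continuous fun p : E × ℝ => f p.1 p.2) {ybar : E → ℝ} (hy : Continuous ybar)
    {σ : E → ℝ → ℝ} (hσ : Continuous fun p : E × ℝ => σ p.1 p.2)
    (hpos : ∀ x y, ybar x < y → 0 < σ x y) (hneg : ∀ x y, y < ybar x → σ x y < 0)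
    {U : Filter ℕ} {z : ℕ → ℝ → E × ℝ} (hz : ∀ n, SolvesAlong f (z n))
    {k : ℕ → ℝ} (hk : Tendsto k U atTop)
    (hzy : ∀ n, ∀ t ∈ Ici (0 : ℝ), HasDerivWithinAt (fun s => (z n s).2)
      (-k n * σ (z n t).1 (z n t).2) (Ici 0) t)
    (hb : LocallyBoundedAlong U z) : TracksAlong U ybar z := by
  intro t ht
  rw [Metric.tendsto_nhds]
  intro δ hδ
  have h1 := eventually_sub_le_of_highGain hf hy hσ hpos hz hk hzy hb ht hδ
  have h2 := eventually_sub_le_of_highGain (f := fun x y => f x (-y)) (ybar := fun x => -ybar x)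
    (σ := fun x y => -σ x (-y)) (z := fun n s => ((z n s).1, -(z n s).2)) (U := U) (k := k)
    (hf.comp (continuous_fst.prodMk continuous_snd.neg)) hy.neg
    (hσ.comp (continuous_fst.prodMk continuous_snd.neg)).neg
    (fun x y h => by have := hneg x (-y) (by linarith); linarith)
    (fun n s hs => by simpa using hz n s hs) hk
    (fun n s hs => by simpa using (hzy n s hs).fun_neg)
    (fun T => (hb T).imp fun R hR => hR.mono fun n hn u hu => by
      simpa [Prod.norm_def] using hn u hu) ht hδ
  filter_upwards [h1, h2] with p hp1 hp2
  rw [Real.dist_eq, sub_zero, abs_lt]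
  constructor <;> linarith

end Limits

/-- A homogeneous cascade `ẋ = f(x, y)`, `ẏ = -k σ(x, y)` where the sign of `σ` is that of
`y - ybar x`. -/
structure HomCascade (n : ℕ) where
  r : Fin n → ℝ
  rn : ℝ
  κ : ℝ
  f : (Fin n → ℝ) → ℝ → (Fin n → ℝ)
  ybar : (Fin n → ℝ) → ℝ
  σ : (Fin n → ℝ) → ℝ → ℝ
  r_pos : ∀ i, 0 < r i
  rn_pos : 0 < rn
  f_cont : Continuous fun p : (Fin n → ℝ) × ℝ => f p.1 p.2
  f_hom : ∀ i, ∀ lam > (0 : ℝ), ∀ x y,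
    f (dil r lam x) (lam ^ rn * y) i = lam ^ (r i + κ) * f x y i
  ybar_cont : Continuous ybar
  ybar_hom : ∀ lam > (0 : ℝ), ∀ x, ybar (dil r lam x) = lam ^ rn * ybar x
  σ_cont : Continuous fun p : (Fin n → ℝ) × ℝ => σ p.1 p.2
  σ_pos : ∀ x y, ybar x < y → 0 < σ x y
  σ_neg : ∀ x y, y < ybar x → σ x y < 0
  σ_hom : ∀ lam > (0 : ℝ), ∀ x y, σ (dil r lam x) (lam ^ rn * y) = lam ^ (rn + κ) * σ x y

namespace HomCascade

variable {n : ℕ} (C : HomCascade n)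

/-- The closed-loop vector field with gain `k`. -/
def closedLoop (k : ℝ) (p : (Fin n → ℝ) × ℝ) : (Fin n → ℝ) × ℝ :=
  (C.f p.1 p.2, -k * C.σ p.1 p.2)

/-- The homogeneous norm on the extended state space. -/
noncomputable def homNorm (z : (Fin n → ℝ) × ℝ) : ℝ :=
  ∑ i, |z.1 i| ^ (1 / C.r i) + |z.2| ^ (1 / C.rn)

/-- The dilation on the extended state space. -/
noncomputable def dilate (lam : ℝ) (z : (Fin n → ℝ) × ℝ) : (Fin n → ℝ) × ℝ :=
  (dil C.r lam z.1, lam ^ C.rn * z.2)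

/-- Rescaling of trajectories. -/
noncomputable def rescale (lam : ℝ) (z : ℝ → (Fin n → ℝ) × ℝ) (t : ℝ) : (Fin n → ℝ) × ℝ :=
  C.dilate lam (z (lam ^ C.κ * t))

/-- A bound for the norm in terms of the homogeneous norm. -/
noncomputable def normBound (a : ℝ) : ℝ := ∑ i, a ^ C.r i + a ^ C.rn

theorem homNorm_nonneg (z : (Fin n → ℝ) × ℝ) : 0 ≤ C.homNorm z := by
  unfold homNorm; positivity

theorem continuous_homNorm : Continuous C.homNorm := by
  unfold homNorm
  refine (continuous_finsetSum _ fun i _ => ?_).add ?_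
  · exact ((continuous_apply i).comp continuous_fst).abs.rpow_const fun _ =>
      Or.inr (one_div_pos.2 (C.r_pos i)).le
  · exact continuous_snd.abs.rpow_const fun _ => Or.inr (one_div_pos.2 C.rn_pos).le

theorem homNorm_zero : C.homNorm 0 = 0 := by
  unfold homNorm
  have h1 : ∀ i, (0 : ℝ) ^ (1 / C.r i) = 0 := fun i =>
    Real.zero_rpow (one_div_pos.2 (C.r_pos i)).ne'
  have h2 : (0 : ℝ) ^ (1 / C.rn) = 0 := Real.zero_rpow (one_div_pos.2 C.rn_pos).ne'
  simp only [Prod.fst_zero, Prod.snd_zero, Pi.zero_apply, abs_zero, h1, h2]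
  simp

theorem homNorm_dilate {lam : ℝ} (hl : 0 < lam) (z : (Fin n → ℝ) × ℝ) :
    C.homNorm (C.dilate lam z) = lam * C.homNorm z := by
  have key : ∀ ρ : ℝ, 0 < ρ → ∀ v : ℝ, |lam ^ ρ * v| ^ (1 / ρ) = lam * |v| ^ (1 / ρ) := by
    intro ρ hρ v
    rw [abs_mul, abs_of_pos (Real.rpow_pos_of_pos hl ρ),
      Real.mul_rpow (Real.rpow_pos_of_pos hl ρ).le (abs_nonneg v), ← Real.rpow_mul hl.le,
      mul_one_div_cancel hρ.ne', Real.rpow_one]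
  unfold homNorm dilate dil
  simp only [key _ (C.r_pos _), key _ C.rn_pos, mul_add, Finset.mul_sum]

theorem continuous_normBound : Continuous C.normBound := by
  unfold normBound
  exact (continuous_finsetSum _ fun i _ => Real.continuous_rpow_const (C.r_pos i).le).add
    (Real.continuous_rpow_const C.rn_pos.le)

theorem normBound_zero : C.normBound 0 = 0 := by
  unfold normBound
  simp [Real.zero_rpow (C.r_pos _).ne', Real.zero_rpow C.rn_pos.ne']

theorem norm_le_normBound {z : (Fin n → ℝ) × ℝ} {a : ℝ} (h : C.homNorm z ≤ a) :
    ‖z‖ ≤ C.normBound a := by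
  have ha : 0 ≤ a := (C.homNorm_nonneg z).trans h
  have key : ∀ ρ : ℝ, 0 < ρ → ∀ v : ℝ, |v| ^ (1 / ρ) ≤ a → |v| ≤ a ^ ρ := by
    intro ρ hρ v hv
    have := Real.rpow_le_rpow (by positivity) hv hρ.le
    rwa [← Real.rpow_mul (abs_nonneg v), one_div_mul_cancel hρ.ne', Real.rpow_one] at this
  have hsum : ∀ i, a ^ C.r i ≤ ∑ j, a ^ C.r j := fun i =>
    Finset.single_le_sum (f := fun j => a ^ C.r j) (fun j _ => by positivity) (Finset.mem_univ i)
  have hsum' : ∀ i, |z.1 i| ^ (1 / C.r i) ≤ ∑ j, |z.1 j| ^ (1 / C.r j) := fun i =>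
    Finset.single_le_sum (f := fun j => |z.1 j| ^ (1 / C.r j)) (fun j _ => by positivity)
      (Finset.mem_univ i)
  have hn : 0 ≤ a ^ C.rn := by positivity
  have hn' : 0 ≤ |z.2| ^ (1 / C.rn) := by positivity
  have hs0 : 0 ≤ ∑ j, a ^ C.r j := by positivity
  have hs0' : 0 ≤ ∑ j, |z.1 j| ^ (1 / C.r j) := by positivity
  unfold homNorm at h
  unfold normBound
  refine norm_prod_le_iff.2 ⟨(pi_norm_le_iff_of_nonneg (by positivity)).2 fun i => ?_, ?_⟩
  · rw [Real.norm_eq_abs]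
    linarith [key _ (C.r_pos i) (z.1 i) (by linarith [hsum' i]), hsum i]
  · rw [Real.norm_eq_abs]
    linarith [key _ C.rn_pos z.2 (by linarith)]

theorem exists_homNorm_bound_norm_lt {ε : ℝ} (hε : 0 < ε) :
    ∃ a > 0, ∀ z, C.homNorm z ≤ a → ‖z‖ < ε := by
  have h : ∀ᶠ a in 𝓝 (0 : ℝ), C.normBound a < ε :=
    C.continuous_normBound.continuousAt.eventually_lt_const (by rwa [C.normBound_zero])
  obtain ⟨a, ha, ha0⟩ := ((h.filter_mono nhdsWithin_le_nhds).and
    (self_mem_nhdsWithin : Ioi (0 : ℝ) ∈ 𝓝[>] 0)).exists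
  exact ⟨a, ha0, fun z hz => (C.norm_le_normBound hz).trans_lt ha⟩

theorem exists_norm_bound_homNorm_lt {ε : ℝ} (hε : 0 < ε) :
    ∃ η > 0, ∀ z, ‖z‖ < η → C.homNorm z < ε := by
  have h : ∀ᶠ z in 𝓝 0, C.homNorm z < ε :=
    C.continuous_homNorm.continuousAt.eventually_lt_const (by rwa [C.homNorm_zero])
  obtain ⟨η, hη, hb⟩ := Metric.eventually_nhds_iff_ball.1 h
  exact ⟨η, hη, fun z hz => hb z (by simpa using hz)⟩

theorem eq_zero_of_homNorm_le {z : (Fin n → ℝ) × ℝ} (h : C.homNorm z ≤ 0) : z = 0 :=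
  norm_le_zero_iff.1 ((C.norm_le_normBound h).trans C.normBound_zero.le)

theorem homNorm_rescale {lam : ℝ} (hl : 0 < lam) (z : ℝ → (Fin n → ℝ) × ℝ) (t : ℝ) :
    C.homNorm (C.rescale lam z t) = lam * C.homNorm (z (lam ^ C.κ * t)) :=
  C.homNorm_dilate hl _

variable {C}

theorem _root_.IsSolOn.solvesAlong {k : ℝ} {z : ℝ → (Fin n → ℝ) × ℝ}
    (hz : IsSolOn (C.closedLoop k) z 0) : SolvesAlong C.f z := fun t ht => by
  have := (hz t ht).hasFDerivWithinAt.fst.hasDerivWithinAt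
  simpa [closedLoop] using this

theorem _root_.IsSolOn.hasDerivWithinAt_snd {k : ℝ} {z : ℝ → (Fin n → ℝ) × ℝ}
    (hz : IsSolOn (C.closedLoop k) z 0) {t : ℝ} (ht : t ∈ Ici (0 : ℝ)) :
    HasDerivWithinAt (fun s => (z s).2) (-k * C.σ (z t).1 (z t).2) (Ici 0) t := by
  have := (hz t ht).hasFDerivWithinAt.snd.hasDerivWithinAt
  simpa [closedLoop] using this

theorem _root_.IsSolOn.continuousOn {E : Type*} [NormedAddCommGroup E] [NormedSpace ℝ E]
    {F : E → E} {z : ℝ → E} {s : ℝ} (hz : IsSolOn F z s) : ContinuousOn z (Ici s) :=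
  fun t ht => (hz t ht).continuousWithinAt

theorem _root_.IsSolOn.comp_const_add {E : Type*} [NormedAddCommGroup E] [NormedSpace ℝ E]
    {F : E → E} {z : ℝ → E} (hz : IsSolOn F z 0) {a : ℝ} (ha : 0 ≤ a) :
    IsSolOn F (fun t => z (a + t)) 0 := by
  intro t ht
  have h : HasDerivWithinAt (fun t => a + t) 1 (Ici 0) t := by
    simpa using (hasDerivWithinAt_id t (Ici 0)).const_add a
  have := HasDerivWithinAt.scomp t (hz (a + t) (add_nonneg ha ht)) h
    fun u hu => add_nonneg ha hu
  rw [one_smul] at this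
  exact this

theorem _root_.SolvesAlong.rescale {z : ℝ → (Fin n → ℝ) × ℝ} (hz : SolvesAlong C.f z)
    {lam : ℝ} (hl : 0 < lam) : SolvesAlong C.f (C.rescale lam z) := by
  intro t ht
  have hlk : 0 < lam ^ C.κ := Real.rpow_pos_of_pos hl _
  have h : HasDerivWithinAt (fun t => lam ^ C.κ * t) (lam ^ C.κ) (Ici 0) t := by
    simpa using (hasDerivWithinAt_id t (Ici 0)).const_mul (lam ^ C.κ)
  have h1 := HasDerivWithinAt.scomp t (hz _ (mul_nonneg hlk.le ht)) h
    fun u hu => mul_nonneg hlk.le hu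
  rw [hasDerivWithinAt_pi] at h1 ⊢
  intro i
  have h2 := (h1 i).const_mul (lam ^ C.r i)
  simp only [HomCascade.rescale, dilate, C.f_hom i lam hl, Real.rpow_add hl]
  simpa [dil, mul_assoc] using h2

theorem _root_.IsSolOn.rescale {k : ℝ} {z : ℝ → (Fin n → ℝ) × ℝ}
    (hz : IsSolOn (C.closedLoop k) z 0) {lam : ℝ} (hl : 0 < lam) :
    IsSolOn (C.closedLoop k) (C.rescale lam z) 0 := by
  intro t ht
  have hlk : 0 < lam ^ C.κ := Real.rpow_pos_of_pos hl _
  have h : HasDerivWithinAt (fun t => lam ^ C.κ * t) (lam ^ C.κ) (Ici 0) t := by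
    simpa using (hasDerivWithinAt_id t (Ici 0)).const_mul (lam ^ C.κ)
  have h1 := (HasDerivWithinAt.scomp t (hz.hasDerivWithinAt_snd (mul_nonneg hlk.le ht)) h
    fun u hu => mul_nonneg hlk.le hu).const_mul (lam ^ C.rn)
  refine (hz.solvesAlong.rescale hl t ht).prodMk ?_
  show HasDerivWithinAt (fun s => lam ^ C.rn * (z (lam ^ C.κ * s)).2)
    (-k * C.σ (dil C.r lam (z (lam ^ C.κ * t)).1) (lam ^ C.rn * (z (lam ^ C.κ * t)).2)) (Ici 0) t
  rw [C.σ_hom lam hl, Real.rpow_add hl]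
  refine h1.congr_deriv ?_
  rw [smul_eq_mul]
  ring

variable (C)

/-- The reduced vector field, obtained by substituting `y = ybar x`. -/
def reduced (x : Fin n → ℝ) : Fin n → ℝ := C.f x (C.ybar x)

/-- The point of the graph of `ybar` above `x`. -/
def graphPt (x : Fin n → ℝ) : (Fin n → ℝ) × ℝ := (x, C.ybar x)

theorem continuous_graphPt : Continuous C.graphPt := continuous_id.prodMk C.ybar_cont

theorem graphPt_dil {lam : ℝ} (hl : 0 < lam) (x : Fin n → ℝ) :
    C.graphPt (dil C.r lam x) = C.dilate lam (C.graphPt x) :=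
  Prod.ext rfl (C.ybar_hom lam hl x)

theorem graphPt_zero : C.graphPt 0 = 0 := by
  have h := C.ybar_hom 2 two_pos 0
  have h0 : dil C.r 2 (0 : Fin n → ℝ) = 0 := by ext i; simp [dil]
  rw [h0] at h
  have h2 : (1 : ℝ) < 2 ^ C.rn := Real.one_lt_rpow one_lt_two C.rn_pos
  have h3 : C.ybar 0 = 0 := by
    have : ((2 : ℝ) ^ C.rn - 1) * C.ybar 0 = 0 := by linarith
    exact (mul_eq_zero.1 this).resolve_left (by linarith)
  exact Prod.ext rfl h3

variable {C}

theorem solvesAlong_graphPt {x : ℝ → Fin n → ℝ} (hx : IsSolOn C.reduced x 0) :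
    SolvesAlong C.f fun t => C.graphPt (x t) := hx

theorem isSolOn_reduced_rescale {x : ℝ → Fin n → ℝ} (hx : IsSolOn C.reduced x 0)
    {lam : ℝ} (hl : 0 < lam) :
    IsSolOn C.reduced (fun t => dil C.r lam (x (lam ^ C.κ * t))) 0 := by
  have h := (solvesAlong_graphPt hx).rescale hl
  intro t ht
  have := h t ht
  simp only [rescale, ← C.graphPt_dil hl] at this
  exact this

/-- Stability of the reduced system is a linear bound of the homogeneous norm. -/
theorem exists_bound_of_reduced_stable (hs : AsympStable C.reduced) :
    ∃ B ≥ 1, ∀ x, IsSolOn C.reduced x 0 → ∀ a > 0, C.homNorm (C.graphPt (x 0)) ≤ a →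
      ∀ t ≥ 0, C.homNorm (C.graphPt (x t)) ≤ B * a := by
  obtain ⟨η, hη, hst⟩ := hs.1 1 one_pos
  obtain ⟨b, hb, hbη⟩ := C.exists_homNorm_bound_norm_lt hη
  obtain ⟨D, hD0, hD⟩ := exists_norm_le_of_norm_le
    (C.continuous_homNorm.comp C.continuous_graphPt) 1
  refine ⟨max 1 (D / b), le_max_left _ _, fun x hx a ha h0 t ht => ?_⟩
  have hl : 0 < b / a := by positivity
  have hlk : 0 < (b / a) ^ C.κ := Real.rpow_pos_of_pos hl _
  have h1 := hst _ (isSolOn_reduced_rescale hx hl) (by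
    refine (norm_fst_le (C.graphPt (dil C.r (b / a) (x ((b / a) ^ C.κ * 0))))).trans_lt (hbη _ ?_)
    rw [C.graphPt_dil hl, C.homNorm_dilate hl, mul_zero]
    calc b / a * C.homNorm (C.graphPt (x 0)) ≤ b / a * a := by gcongr
      _ = b := by field_simp) (t / (b / a) ^ C.κ) (by positivity)
  have h2 := (le_abs_self _).trans (hD _ h1.le)
  simp only [Function.comp, C.graphPt_dil hl, C.homNorm_dilate hl, mul_div_cancel₀ t hlk.ne'] at h2
  calc C.homNorm (C.graphPt (x t)) = a / b * (b / a * C.homNorm (C.graphPt (x t))) := by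
        field_simp
    _ ≤ a / b * D := by gcongr
    _ = D / b * a := by ring
    _ ≤ max 1 (D / b) * a := by gcongr; exact le_max_right _ _

/-- No solution of the reduced system stays away from the origin. -/
theorem not_forall_le_homNorm_reduced (hs : AsympStable C.reduced) {x : ℝ → Fin n → ℝ}
    (hx : IsSolOn C.reduced x 0) {c : ℝ} (hc : 0 < c) :
    ¬ ∀ t > 0, c ≤ C.homNorm (C.graphPt (x t)) := by
  intro h
  obtain ⟨δ, hδ, hat⟩ := hs.2
  obtain ⟨b, hb, hbδ⟩ := C.exists_homNorm_bound_norm_lt hδ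
  set A := C.homNorm (C.graphPt (x 0)) with hA
  have hA0 : 0 ≤ A := C.homNorm_nonneg _
  have hl : 0 < b / (A + 1) := by positivity
  have hlk : 0 < (b / (A + 1)) ^ C.κ := Real.rpow_pos_of_pos hl _
  have h1 := hat _ (isSolOn_reduced_rescale hx hl) (by
    refine (norm_fst_le (C.graphPt (dil C.r (b / (A + 1))
      (x ((b / (A + 1)) ^ C.κ * 0))))).trans_lt (hbδ _ ?_)
    rw [C.graphPt_dil hl, C.homNorm_dilate hl, mul_zero, ← hA, div_mul_eq_mul_div,
      div_le_iff₀ (by positivity)]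
    nlinarith)
  have h2 := ((C.continuous_homNorm.comp C.continuous_graphPt).tendsto 0).comp h1
  simp only [Function.comp_def, C.graphPt_zero, C.homNorm_zero, C.graphPt_dil hl,
    C.homNorm_dilate hl] at h2
  obtain ⟨t, ht1, ht2⟩ := ((h2.eventually_lt_const (mul_pos hl hc)).and
    (eventually_gt_atTop 0)).exists
  have := h _ (mul_pos hlk ht2)
  have := mul_le_mul_of_nonneg_left this hl.le
  linarith

theorem not_persistent_of_tracks (hs : AsympStable C.reduced)
    {z : ℕ → ℝ → (Fin n → ℝ) × ℝ} (hz : ∀ m, SolvesAlong C.f (z m))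
    (hb : LocallyBoundedAlong (hyperfilter ℕ) z) (htr : TracksAlong (hyperfilter ℕ) C.ybar z)
    {c : ℝ} (hc : 0 < c) : ¬ ∀ m : ℕ, ∀ t ∈ Icc (0 : ℝ) m, c ≤ C.homNorm (z m t) := by
  intro h
  obtain ⟨w, hw, -, hlim⟩ := SolvesAlong.exists_limit C.f_cont C.ybar_cont hz hb htr
  refine not_forall_le_homNorm_reduced hs hw hc fun t ht => ?_
  have h1 : Tendsto (fun m : ℕ => (m, t)) (hyperfilter ℕ) (hyperfilter ℕ ×ˢ 𝓝 t) :=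
    tendsto_id.prodMk tendsto_const_nhds
  refine ge_of_tendsto ((C.continuous_homNorm.tendsto _).comp ((hlim t ht).comp h1)) ?_
  have h2 : ∀ᶠ m : ℕ in hyperfilter ℕ, t ≤ m :=
    Nat.hyperfilter_le_atTop (eventually_atTop.2 ⟨⌈t⌉₊, fun m hm => Nat.ceil_le.1 hm⟩)
  filter_upwards [h2] with m hm using h m t ⟨ht.le, hm⟩

theorem locallyBoundedAlong_of_homNorm_le {U : Filter ℕ} {z : ℕ → ℝ → (Fin n → ℝ) × ℝ}
    (h : ∀ T : ℝ, ∃ R : ℝ, ∀ᶠ m in U, ∀ t ∈ Icc 0 T, C.homNorm (z m t) ≤ R) :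
    LocallyBoundedAlong U z := fun T => by
  obtain ⟨R, hR⟩ := h T
  exact ⟨C.normBound R, hR.mono fun m hm t ht => C.norm_le_normBound (hm t ht)⟩

/-- Uniform attractivity of the reduced system. -/
theorem exists_time_reduced_lt (hs : AsympStable C.reduced) :
    ∃ T > 0, ∀ x, IsSolOn C.reduced x 0 → C.homNorm (C.graphPt (x 0)) ≤ 1 →
      C.homNorm (C.graphPt (x T)) < 1 := by
  obtain ⟨B, hB, hbd⟩ := exists_bound_of_reduced_stable hs
  by_contra! hcon
  choose! x hx hx0 hx1 using fun m : ℕ => hcon (m + 1) (by positivity)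
  have hB0 : 0 < B := by linarith
  refine not_persistent_of_tracks hs (z := fun m t => C.graphPt (x m t))
    (fun m => solvesAlong_graphPt (hx m))
    (locallyBoundedAlong_of_homNorm_le fun T => ⟨B * 1, Eventually.of_forall fun m t ht =>
      hbd _ (hx m) 1 one_pos (hx0 m) t ht.1⟩) ?_ (c := 1 / (2 * B)) (by positivity) ?_
  · intro t _
    simp [graphPt]
  · intro m t ht
    by_contra! hlt
    have := hbd _ ((hx m).comp_const_add ht.1) (1 / (2 * B)) (by positivity)
      (by simpa using hlt.le) (m + 1 - t) (by linarith [ht.2])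
    have h3 : B * (1 / (2 * B)) = 1 / 2 := by field_simp
    rw [h3, add_sub_cancel] at this
    linarith [hx1 m]

theorem homNorm_rescale_inv {a : ℝ} (ha : 0 < a) (z : ℝ → (Fin n → ℝ) × ℝ) (t : ℝ) :
    C.homNorm (C.rescale a⁻¹ z t) = a⁻¹ * C.homNorm (z (a ^ (-C.κ) * t)) := by
  rw [C.homNorm_rescale (inv_pos.2 ha), Real.inv_rpow ha.le, Real.rpow_neg ha.le]

theorem homNorm_rescale_inv_zero_le {a : ℝ} (ha : 0 < a) {z : ℝ → (Fin n → ℝ) × ℝ}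
    (h : C.homNorm (z 0) ≤ a) : C.homNorm (C.rescale a⁻¹ z 0) ≤ 1 := by
  rw [homNorm_rescale_inv ha, mul_zero, inv_mul_le_iff₀ ha]
  simpa using h

/-- An a priori bound for the second component as long as the first one is bounded. -/
theorem abs_snd_le {k : ℝ} (hk : 0 < k) {z : ℝ → (Fin n → ℝ) × ℝ}
    (hz : IsSolOn (C.closedLoop k) z 0) {b Y : ℝ} (hY : ∀ u ∈ Ico 0 b, |C.ybar (z u).1| < Y)
    (h0 : |(z 0).2| ≤ Y) {t : ℝ} (ht : t ∈ Icc 0 b) : |(z t).2| ≤ Y := by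
  have hcont : ContinuousOn (fun u => (z u).2) (Icc 0 b) :=
    (continuous_snd.comp_continuousOn hz.continuousOn).mono fun u hu => hu.1
  have hder : ∀ u ∈ Ico 0 b, HasDerivWithinAt (fun u => (z u).2)
      (-k * C.σ (z u).1 (z u).2) (Ici u) u := fun u hu =>
    (hz.hasDerivWithinAt_snd hu.1).mono fun v hv => le_trans hu.1 hv
  have h1 := image_le_of_deriv_right_lt_deriv_boundary (B := fun _ => Y) (B' := fun _ => 0)
    hcont hder (abs_le.1 h0).2 (fun u => hasDerivAt_const u Y) (fun u hu h => by
      have := C.σ_pos (z u).1 (z u).2 (by rw [h]; exact (abs_lt.1 (hY u hu)).2)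
      nlinarith) ht
  have h2 := image_le_of_deriv_right_lt_deriv_boundary (B := fun _ => Y) (B' := fun _ => 0)
    (f := fun u => -(z u).2) (f' := fun u => -(-k * C.σ (z u).1 (z u).2))
    hcont.neg (fun u hu => (hder u hu).fun_neg) (by linarith [(abs_le.1 h0).1])
    (fun u => hasDerivAt_const u Y) (fun u hu h => by
      have := C.σ_neg (z u).1 (z u).2 (by linarith [(abs_lt.1 (hY u hu)).1])
      nlinarith) ht
  exact abs_le.2 ⟨by linarith, h1⟩

variable (C)

/-- The closed-loop growth over a short time is bounded uniformly in the gain. -/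
theorem exists_growth_bound_unit : ∃ B ≥ 1, ∃ τ > 0, ∀ k > 0, ∀ z, IsSolOn (C.closedLoop k) z 0 →
    C.homNorm (z 0) ≤ 1 → ∀ t ∈ Icc 0 τ, C.homNorm (z t) ≤ B := by
  set ρ := C.normBound 1 with hρ
  obtain ⟨Y₀, hY₀0, hY₀⟩ := exists_norm_le_of_norm_le C.ybar_cont (ρ + 1)
  set Y := max Y₀ ρ + 1 with hY
  have hYY : Y₀ < Y := lt_of_le_of_lt (le_max_left _ ρ) (lt_add_one _)
  have hYρ : ρ < Y := lt_of_le_of_lt (le_max_right Y₀ _) (lt_add_one _)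
  set R := max (ρ + 1) Y with hR
  obtain ⟨L, hL0, hL⟩ := exists_norm_le_of_norm_le C.f_cont R
  obtain ⟨B, hB0, hB⟩ := exists_norm_le_of_norm_le C.continuous_homNorm R
  refine ⟨max B 1, le_max_right _ _, 1 / (2 * L), by positivity, fun k hk z hz h0 t ht => ?_⟩
  have hz0 : ‖z 0‖ ≤ ρ := C.norm_le_normBound h0
  have hcont1 : ContinuousOn (fun u => ‖(z u).1‖) (Ici 0) :=
    (continuous_fst.comp_continuousOn hz.continuousOn).norm
  have hsnd : ∀ b, (∀ u ∈ Ico 0 b, ‖(z u).1‖ < ρ + 1) → ∀ u ∈ Icc 0 b, |(z u).2| ≤ Y :=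
    fun b hb u hu => abs_snd_le hk hz (fun v hv => (hY₀ _ (hb v hv).le).trans_lt hYY)
      ((norm_snd_le (z 0)).trans (hz0.trans hYρ.le)) hu
  have hfst : ∀ u ∈ Icc 0 t, ‖(z u).1‖ < ρ + 1 := by
    by_contra! hcon
    obtain ⟨u₀, hu₀, hu₀'⟩ := hcon
    have hclosed : IsCompact (Icc 0 t ∩ {u | ρ + 1 ≤ ‖(z u).1‖}) := by
      refine isCompact_Icc.of_isClosed_subset ?_ inter_subset_left
      exact (hcont1.mono fun u hu => hu.1).preimage_isClosed_of_isClosed isClosed_Icc isClosed_Ici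
    obtain ⟨t₁, ht₁, hleast⟩ := hclosed.exists_isLeast ⟨u₀, hu₀, hu₀'⟩
    have hlt : ∀ u ∈ Ico 0 t₁, ‖(z u).1‖ < ρ + 1 := by
      intro u hu
      by_contra! h
      exact absurd (hleast ⟨⟨hu.1, hu.2.le.trans ht₁.1.2⟩, h⟩) (not_le.2 hu.2)
    have h1 := norm_image_sub_le_of_norm_deriv_le_segment' (a := 0) (b := t₁) (C := L)
      (fun u hu => (hz.solvesAlong u hu.1).mono fun v hv => hv.1)
      (fun u hu => hL _ (norm_prod_le_iff.2 ⟨(hlt u hu).le.trans (le_max_left _ _),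
        (hsnd t₁ hlt u ⟨hu.1, hu.2.le⟩).trans (le_max_right _ _)⟩)) t₁ ⟨ht₁.1.1, le_rfl⟩
    have h2 : L * (t₁ - 0) ≤ L * (1 / (2 * L)) := by
      gcongr; linarith [ht₁.1.2, ht.2]
    have h3 : L * (1 / (2 * L)) = 1 / 2 := by field_simp
    have h4 : ρ + 1 ≤ ‖(z t₁).1‖ := ht₁.2
    have h5 := norm_sub_norm_le (z t₁).1 (z 0).1
    have h6 := (norm_fst_le (z 0)).trans hz0
    linarith
  have htt : t ∈ Icc 0 t := ⟨ht.1, le_rfl⟩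
  refine le_trans ((le_abs_self _).trans (hB _ (norm_prod_le_iff.2 ⟨?_, ?_⟩))) (le_max_left _ _)
  · exact (hfst t htt).le.trans (le_max_left _ _)
  · exact (hsnd t (fun u hu => hfst u ⟨hu.1, hu.2.le⟩) t htt).trans (le_max_right _ _)

theorem exists_growth_bound : ∃ B ≥ 1, ∃ τ > 0, ∀ k > 0, ∀ z, IsSolOn (C.closedLoop k) z 0 →
    ∀ a > 0, C.homNorm (z 0) ≤ a → ∀ t ∈ Icc 0 (τ * a ^ (-C.κ)), C.homNorm (z t) ≤ B * a := by
  obtain ⟨B, hB, τ, hτ, h⟩ := C.exists_growth_bound_unit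
  refine ⟨B, hB, τ, hτ, fun k hk z hz a ha h0 t ht => ?_⟩
  have hak : 0 < a ^ (-C.κ) := Real.rpow_pos_of_pos ha _
  have := h k hk _ (hz.rescale (inv_pos.2 ha)) (homNorm_rescale_inv_zero_le ha h0)
    (t / a ^ (-C.κ)) ⟨div_nonneg ht.1 hak.le, by rw [div_le_iff₀ hak]; exact ht.2⟩
  rw [homNorm_rescale_inv ha, mul_div_cancel₀ t hak.ne', inv_mul_le_iff₀ ha] at this
  linarith

variable {C}

/-- Iterated growth bound for nonpositive degree. -/
theorem homNorm_le_pow_of_growth {B τ k : ℝ} (hB : 1 ≤ B) (hκ : C.κ ≤ 0)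
    (hg : ∀ z, IsSolOn (C.closedLoop k) z 0 → ∀ a > 0, C.homNorm (z 0) ≤ a →
      ∀ t ∈ Icc 0 (τ * a ^ (-C.κ)), C.homNorm (z t) ≤ B * a) (hτ : 0 < τ) (i : ℕ) :
    ∀ z, IsSolOn (C.closedLoop k) z 0 → ∀ a > 0, C.homNorm (z 0) ≤ a →
      ∀ t ∈ Icc 0 (i * τ * a ^ (-C.κ)), C.homNorm (z t) ≤ B ^ i * a := by
  induction i with
  | zero =>
    intro z hz a ha h0 t ht
    have : t = 0 := by simpa using ht
    simpa [this] using h0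
  | succ i ih =>
    intro z hz a ha h0 t ht
    have hak : 0 < a ^ (-C.κ) := Real.rpow_pos_of_pos ha _
    rcases le_total t (τ * a ^ (-C.κ)) with h | h
    · refine (hg z hz a ha h0 t ⟨ht.1, h⟩).trans ?_
      gcongr
      exact le_self_pow₀ hB i.succ_ne_zero
    · have hs : 0 ≤ τ * a ^ (-C.κ) := by positivity
      have hmono : a ^ (-C.κ) ≤ (B * a) ^ (-C.κ) :=
        Real.rpow_le_rpow ha.le (le_mul_of_one_le_left ha.le hB) (by linarith)
      have h1 := ih _ (hz.comp_const_add hs) (B * a) (by positivity)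
        (by simpa using hg z hz a ha h0 _ ⟨hs, le_rfl⟩) (t - τ * a ^ (-C.κ))
        ⟨by linarith, ?_⟩
      · rw [add_sub_cancel] at h1
        rw [pow_succ, mul_assoc]; exact h1
      · have h2 := ht.2
        push_cast at h2
        have h3 : i * τ * a ^ (-C.κ) ≤ i * τ * (B * a) ^ (-C.κ) := by gcongr
        linarith

/-- Doubling selection: among the record points of a function bounded on bounded sets there is one
after which the function does not double on the natural time scale. -/
theorem exists_record_no_doubling {g : ℝ → ℝ} (hg : ContinuousOn g (Ici 0)) {κ j t₀ : ℝ}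
    (hκ : 0 < κ) (hj : 0 ≤ j) (ht₀ : 0 ≤ t₀) (hg₀ : 0 < g t₀)
    (hrec : ∀ u ∈ Icc 0 t₀, g u ≤ g t₀) :
    ∃ t ≥ t₀, (∀ u ∈ Icc 0 t, g u ≤ g t) ∧
      ∀ u ∈ Icc t (t + j * g t ^ (-κ)), g u ≤ 2 * g t := by
  by_contra! hcon
  have h2κ : (2 : ℝ) ^ (-κ) < 1 := Real.rpow_lt_one_of_one_lt_of_neg one_lt_two (by linarith)
  set c := 1 / (1 - (2 : ℝ) ^ (-κ)) with hc
  have hc0 : 0 < c := one_div_pos.2 (by linarith)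
  have hc1 : 1 + c * 2 ^ (-κ) = c := by
    rw [hc]; field_simp [show (1 : ℝ) - 2 ^ (-κ) ≠ 0 by linarith]; ring
  set Tend := t₀ + c * j * g t₀ ^ (-κ) with hTend
  set S := {t | t₀ ≤ t ∧ (∀ u ∈ Icc 0 t, g u ≤ g t) ∧ t + c * j * g t ^ (-κ) ≤ Tend} with hS
  have hpos : ∀ t ∈ S, 0 < g t := fun t ht =>
    hg₀.trans_le (ht.2.1 t₀ ⟨ht₀, ht.1⟩)
  have hSle : ∀ t ∈ S, t ∈ Icc 0 Tend := fun t ht => by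
    have := hpos t ht
    have h1 : 0 ≤ c * j * g t ^ (-κ) := by positivity
    exact ⟨ht₀.trans ht.1, by linarith [ht.2.2]⟩
  obtain ⟨D, hD⟩ := isCompact_Icc.bddAbove_image (hg.mono (fun u hu => hu.1 : Icc 0 Tend ⊆ Ici 0))
  have hbdd : BddAbove (g '' S) := ⟨D, by
    rintro _ ⟨t, ht, rfl⟩; exact hD ⟨t, hSle t ht, rfl⟩⟩
  have hmem : t₀ ∈ S := ⟨le_rfl, hrec, le_rfl⟩
  have hsup : 0 < sSup (g '' S) := hg₀.trans_le (le_csSup hbdd ⟨t₀, hmem, rfl⟩)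
  obtain ⟨_, ⟨t, htS, rfl⟩, htgt⟩ := exists_lt_of_lt_csSup (Set.Nonempty.image g ⟨t₀, hmem⟩)
    (half_lt_self hsup)
  obtain ⟨u, hu, hgu⟩ := hcon t htS.1 htS.2.1
  have ht0 : 0 ≤ t := ht₀.trans htS.1
  have hgt := hpos t htS
  obtain ⟨v, hv, hvmax⟩ := (isCompact_Icc (a := (0 : ℝ)) (b := u)).exists_isMaxOn
    ⟨0, le_rfl, ht0.trans hu.1⟩ (hg.mono fun x hx => hx.1)
  have hgv : 2 * g t < g v := hgu.trans_le (hvmax ⟨ht0.trans hu.1, le_rfl⟩)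
  have htv : t ≤ v := by
    by_contra! h
    have := htS.2.1 v ⟨hv.1, h.le⟩
    linarith
  have hvS : v ∈ S := by
    refine ⟨htS.1.trans htv, fun x hx => hvmax ⟨hx.1, hx.2.trans hv.2⟩, ?_⟩
    have h1 : g v ^ (-κ) ≤ (2 * g t) ^ (-κ) :=
      Real.rpow_le_rpow_of_nonpos (by positivity) hgv.le (by linarith)
    rw [Real.mul_rpow zero_le_two hgt.le] at h1
    have h2 : c * j * g v ^ (-κ) ≤ c * j * (2 ^ (-κ) * g t ^ (-κ)) := by gcongr
    have h3 : j * g t ^ (-κ) + c * j * (2 ^ (-κ) * g t ^ (-κ)) = c * j * g t ^ (-κ) := by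
      linear_combination (j * g t ^ (-κ)) * hc1
    linarith [hv.2, hu.2, htS.2.2]
  have := le_csSup hbdd ⟨v, hvS, rfl⟩
  linarith

variable (C)

/-- A solution with large growth yields, after rescaling, one that starts near the origin,
reaches homogeneous norm one as a record, and remains bounded for a long time. -/
theorem exists_blowup_rescaling : ∃ G : ℝ → ℝ, ∀ j > 0, ∀ k > 0, ∀ z,
    IsSolOn (C.closedLoop k) z 0 → C.homNorm (z 0) ≤ 1 → (∃ s ≥ 0, j < C.homNorm (z s)) →
    ∃ v, IsSolOn (C.closedLoop k) v 0 ∧ C.homNorm (v 0) ≤ 1 / j ∧ ∃ a ≥ 0,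
      C.homNorm (v a) = 1 ∧ (∀ u ∈ Icc 0 a, C.homNorm (v u) ≤ 1) ∧
      ∀ T ≤ j, ∀ u ∈ Icc a (a + T), C.homNorm (v u) ≤ G T := by
  obtain ⟨B, hB, τ, hτ, hg⟩ := C.exists_growth_bound
  refine ⟨fun T => max 2 (B ^ ⌈T / τ⌉₊), fun j hj k hk z hz h0 ⟨s, hs, hjs⟩ => ?_⟩
  have hcont : ContinuousOn (fun u => C.homNorm (z u)) (Ici 0) :=
    C.continuous_homNorm.comp_continuousOn hz.continuousOn
  obtain ⟨t₀, ht₀, hmax⟩ := (isCompact_Icc (a := (0 : ℝ)) (b := s)).exists_isMaxOn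
    ⟨0, le_rfl, hs⟩ (hcont.mono fun x hx => hx.1)
  have hjt₀ : j < C.homNorm (z t₀) := hjs.trans_le (hmax ⟨hs, le_rfl⟩)
  have hrec₀ : ∀ u ∈ Icc 0 t₀, C.homNorm (z u) ≤ C.homNorm (z t₀) :=
    fun u hu => hmax ⟨hu.1, hu.2.trans ht₀.2⟩
  obtain ⟨t, ht, hjt, hrec, hfwd⟩ : ∃ t ≥ 0, j < C.homNorm (z t) ∧
      (∀ u ∈ Icc 0 t, C.homNorm (z u) ≤ C.homNorm (z t)) ∧
      ∀ T ≤ j, ∀ u ∈ Icc t (t + T * C.homNorm (z t) ^ (-C.κ)),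
        C.homNorm (z u) ≤ max 2 (B ^ ⌈T / τ⌉₊) * C.homNorm (z t) := by
    rcases le_or_gt C.κ 0 with hκ | hκ
    · refine ⟨t₀, ht₀.1, hjt₀, hrec₀, fun T hT u hu => ?_⟩
      have hM : 0 < C.homNorm (z t₀) := hj.trans hjt₀
      have h1 := homNorm_le_pow_of_growth hB hκ (hg k hk) hτ ⌈T / τ⌉₊ _
        (hz.comp_const_add ht₀.1) (C.homNorm (z t₀)) hM (by simp) (u - t₀) ⟨by linarith [hu.1], ?_⟩
      · rw [add_sub_cancel] at h1
        exact h1.trans (by gcongr; exact le_max_right _ _)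
      · have h2 : T ≤ ⌈T / τ⌉₊ * τ := by rw [← div_le_iff₀ hτ]; exact Nat.le_ceil _
        have h3 : T * C.homNorm (z t₀) ^ (-C.κ) ≤ ⌈T / τ⌉₊ * τ * C.homNorm (z t₀) ^ (-C.κ) := by
          gcongr
        linarith [hu.2]
    · obtain ⟨t, htt, hrec, hdbl⟩ := exists_record_no_doubling hcont hκ hj.le ht₀.1
        (hj.trans hjt₀) hrec₀
      have hM : j < C.homNorm (z t) := hjt₀.trans_le (hrec t₀ ⟨ht₀.1, htt⟩)
      refine ⟨t, ht₀.1.trans htt, hM, hrec, fun T hT u hu => ?_⟩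
      have hM0 : 0 < C.homNorm (z t) := hj.trans hM
      refine (hdbl u ⟨hu.1, hu.2.trans ?_⟩).trans (by gcongr; exact le_max_left _ _)
      gcongr
  set M := C.homNorm (z t) with hM
  have hM0 : 0 < M := hj.trans hjt
  have hMk : 0 < M ^ (-C.κ) := Real.rpow_pos_of_pos hM0 _
  refine ⟨C.rescale M⁻¹ z, hz.rescale (inv_pos.2 hM0), ?_, t / M ^ (-C.κ), by positivity,
    ?_, fun u hu => ?_, fun T hT u hu => ?_⟩
  · rw [homNorm_rescale_inv hM0, mul_zero, inv_mul_le_iff₀ hM0]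
    refine h0.trans ?_
    rw [mul_one_div, le_div_iff₀ hj]
    linarith
  · rw [homNorm_rescale_inv hM0, mul_div_cancel₀ t hMk.ne', ← hM, inv_mul_cancel₀ hM0.ne']
  · rw [homNorm_rescale_inv hM0, inv_mul_le_iff₀ hM0, mul_one]
    refine hrec _ ⟨mul_nonneg hMk.le hu.1, ?_⟩
    rw [mul_comm, ← le_div_iff₀ hMk]; exact hu.2
  · rw [homNorm_rescale_inv hM0, inv_mul_le_iff₀ hM0, mul_comm M]
    refine hfwd T hT _ ⟨?_, ?_⟩
    · rw [mul_comm, ← div_le_iff₀ hMk]; exact hu.1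
    · have h1 := mul_le_mul_of_nonneg_left hu.2 hMk.le
      rw [mul_add, mul_div_cancel₀ t hMk.ne'] at h1
      linarith

variable {C}

/-- Compactness of locally bounded closed-loop trajectories in the high-gain limit: they converge
to trajectories of the reduced system. -/
theorem exists_limit_of_highGain {U : Ultrafilter ℕ} {z : ℕ → ℝ → (Fin n → ℝ) × ℝ} {k : ℕ → ℝ}
    (hz : ∀ m, IsSolOn (C.closedLoop (k m)) (z m) 0) (hk : Tendsto k U atTop)
    (hb : LocallyBoundedAlong U z) :
    ∃ w, IsSolOn C.reduced w 0 ∧ Tendsto (fun m => (z m 0).1) U (𝓝 (w 0)) ∧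
      ∀ t > 0, ∀ s : ℕ → ℝ, Tendsto s U (𝓝 t) →
        Tendsto (fun m => C.homNorm (z m (s m))) U (𝓝 (C.homNorm (C.graphPt (w t)))) := by
  obtain ⟨w, hw, hw0, hlim⟩ := SolvesAlong.exists_limit C.f_cont C.ybar_cont
    (fun m => (hz m).solvesAlong) hb (tracksAlong_of_highGain C.f_cont C.ybar_cont C.σ_cont C.σ_pos
      C.σ_neg (fun m => (hz m).solvesAlong) hk (fun m t ht => (hz m).hasDerivWithinAt_snd ht) hb)
  refine ⟨w, hw, hw0, fun t ht s hs => ?_⟩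
  exact (C.continuous_homNorm.tendsto _).comp ((hlim t ht).comp (tendsto_id.prodMk hs))

/-- High-gain closed-loop trajectories cannot blow up. -/
theorem exists_bound_unit (hs : AsympStable C.reduced) :
    ∃ k₁ > 0, ∃ B ≥ 1, ∀ k > k₁, ∀ z, IsSolOn (C.closedLoop k) z 0 → C.homNorm (z 0) ≤ 1 →
      ∀ t ≥ 0, C.homNorm (z t) ≤ B := by
  by_contra! hcon
  obtain ⟨G, hG⟩ := C.exists_blowup_rescaling
  choose k hk z hz hz0 t ht hzt using fun j : ℕ =>
    hcon (j + 1) (by positivity) (j + 1) (by simp)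
  have hk0 : ∀ j, 0 < k j := fun j => lt_trans (by positivity) (hk j)
  choose v hv hv0 a ha hva hle hGle using fun j : ℕ =>
    hG (j + 1) (by positivity) (k j) (hk0 j) (z j) (hz j) (hz0 j) ⟨t j, ht j, hzt j⟩
  have hcast : Tendsto (fun j : ℕ => (j : ℝ) + 1) (hyperfilter ℕ) atTop :=
    (tendsto_atTop_add_const_right _ _ tendsto_natCast_atTop_atTop).mono_left
      Nat.hyperfilter_le_atTop
  have hkt : Tendsto k (hyperfilter ℕ) atTop := tendsto_atTop_mono (fun j => (hk j).le) hcast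
  have hbdd : ∀ b : ℕ → ℝ, (∀ j, b j ∈ Icc 0 (a j)) →
      LocallyBoundedAlong (hyperfilter ℕ) fun j t => v j (b j + t) := fun b hb =>
    C.locallyBoundedAlong_of_homNorm_le fun S => ⟨max 1 (G S), by
      filter_upwards [hcast.eventually_ge_atTop S] with j hj u hu
      rcases le_total (b j + u) (a j) with h | h
      · exact (hle j _ ⟨add_nonneg (hb j).1 hu.1, h⟩).trans (le_max_left _ _)
      · exact (hGle j S hj _ ⟨h, add_le_add (hb j).2 hu.2⟩).trans (le_max_right _ _)⟩
  obtain ⟨T, hT, hTlt⟩ := exists_time_reduced_lt hs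
  rcases (Ultrafilter.eventually_or (f := hyperfilter ℕ)
    (p := fun j => T + 1 ≤ a j) (q := fun j => a j ≤ T + 1)).1
    (Eventually.of_forall fun j => le_total _ _) with hlarge | hsmall
  · set b : ℕ → ℝ := fun j => max (a j - (T + 1)) 0 with hbdef
    have hb : ∀ j, b j ∈ Icc 0 (a j) := fun j =>
      ⟨le_max_right _ _, max_le (by linarith) (ha j)⟩
    obtain ⟨w, hw, -, hlim⟩ := exists_limit_of_highGain
      (fun j => (hv j).comp_const_add (hb j).1) hkt (hbdd b hb)
    have hbj : ∀ j, T + 1 ≤ a j → b j = a j - (T + 1) := fun j hj => max_eq_left (by linarith)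
    have h1 : C.homNorm (C.graphPt (w 1)) ≤ 1 := by
      refine le_of_tendsto (hlim 1 one_pos _ tendsto_const_nhds) ?_
      filter_upwards [hlarge] with j hj
      exact hle j _ ⟨add_nonneg (hb j).1 one_pos.le, by rw [hbj j hj]; linarith⟩
    have h2 : C.homNorm (C.graphPt (w (1 + T))) = 1 := by
      refine tendsto_nhds_unique (hlim (1 + T) (by positivity) _ tendsto_const_nhds) ?_
      refine tendsto_const_nhds.congr' ?_
      filter_upwards [hlarge] with j hj
      rw [hbj j hj, show a j - (T + 1) + (1 + T) = a j by ring, hva]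
    have := hTlt _ (hw.comp_const_add one_pos.le) (by simpa using h1)
    linarith
  · obtain ⟨w, hw, hw0, hlim⟩ := exists_limit_of_highGain
      (fun j => (hv j).comp_const_add le_rfl) hkt (hbdd (fun _ => 0) fun j => ⟨le_rfl, ha j⟩)
    simp only [zero_add] at hw0 hlim
    obtain ⟨a', ha', hat⟩ := (isCompact_Icc (a := (0 : ℝ)) (b := T + 1)).ultrafilter_le_nhds
      ((hyperfilter ℕ).map a) (by
        rw [le_principal_iff]
        exact hsmall.mono fun j hj => ⟨ha j, hj⟩)
    have hat : Tendsto a (hyperfilter ℕ) (𝓝 a') := hat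
    have hv00 : Tendsto (fun j : ℕ => 1 / ((j : ℝ) + 1)) (hyperfilter ℕ) (𝓝 0) := by
      simp only [one_div]
      exact hcast.inv_tendsto_atTop
    have hpos : 0 < a' := by
      obtain ⟨B, hB, τ, hτ, hg⟩ := C.exists_growth_bound
      have hB0 : 0 < 1 / (2 * B) := by positivity
      have hτ' : 0 < τ * (1 / (2 * B)) ^ (-C.κ) := mul_pos hτ (Real.rpow_pos_of_pos hB0 _)
      refine lt_of_lt_of_le hτ' (ge_of_tendsto hat ?_)
      filter_upwards [hv00.eventually_le_const hB0] with j hj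
      by_contra! hlt
      have := hg (k j) (hk0 j) _ (hv j) _ hB0 ((hv0 j).trans hj) (a j) ⟨ha j, hlt.le⟩
      rw [hva, show B * (1 / (2 * B)) = 1 / 2 by field_simp] at this
      norm_num at this
    have hone : C.homNorm (C.graphPt (w a')) = 1 := by
      refine tendsto_nhds_unique (hlim a' hpos a hat) ?_
      simp only [hva]
      exact tendsto_const_nhds
    have hzero : w 0 = 0 := by
      have h0 : Tendsto (fun j => v j 0) (hyperfilter ℕ) (𝓝 0) := by
        rw [Metric.tendsto_nhds]
        intro ε hε
        obtain ⟨c, hc, hcε⟩ := C.exists_homNorm_bound_norm_lt hε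
        filter_upwards [hv00.eventually_le_const hc] with j hj
        simpa using hcε _ ((hv0 j).trans hj)
      exact tendsto_nhds_unique hw0 ((continuous_fst.tendsto _).comp h0)
    obtain ⟨B, hB, hBw⟩ := exists_bound_of_reduced_stable hs
    have := hBw w hw (1 / (2 * B)) (by positivity)
      (by rw [hzero, C.graphPt_zero, C.homNorm_zero]; positivity) a' hpos.le
    rw [hone, show B * (1 / (2 * B)) = 1 / 2 by field_simp] at this
    norm_num at this

/-- High-gain closed-loop trajectories are bounded, with a linear bound for the homogeneous
norm. -/
theorem exists_bound (hs : AsympStable C.reduced) :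
    ∃ k₁ > 0, ∃ B ≥ 1, ∀ k > k₁, ∀ z, IsSolOn (C.closedLoop k) z 0 → ∀ a > 0,
      C.homNorm (z 0) ≤ a → ∀ t ≥ 0, C.homNorm (z t) ≤ B * a := by
  obtain ⟨k₁, hk₁, B, hB, h⟩ := exists_bound_unit hs
  refine ⟨k₁, hk₁, B, hB, fun k hk z hz a ha h0 t ht => ?_⟩
  have hak : 0 < a ^ (-C.κ) := Real.rpow_pos_of_pos ha _
  have := h k hk _ (hz.rescale (inv_pos.2 ha)) (homNorm_rescale_inv_zero_le ha h0)
    (t / a ^ (-C.κ)) (div_nonneg ht hak.le)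
  rw [homNorm_rescale_inv ha, mul_div_cancel₀ t hak.ne', inv_mul_le_iff₀ ha] at this
  linarith

/-- Uniform boundedness and contraction of the high-gain closed loop. -/
theorem exists_contraction (hs : AsympStable C.reduced) :
    ∃ k₀ > 0, ∃ B ≥ 1, ∃ T > 0, ∀ k > k₀, ∀ z, IsSolOn (C.closedLoop k) z 0 → ∀ a > 0,
      C.homNorm (z 0) ≤ a → (∀ t ≥ 0, C.homNorm (z t) ≤ B * a) ∧
        ∀ t ≥ T * a ^ (-C.κ), C.homNorm (z t) ≤ a / 2 := by
  obtain ⟨k₁, hk₁, B, hB, hbd⟩ := exists_bound hs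
  have hunit : ∃ m : ℕ, ∀ k > max k₁ m, ∀ z, IsSolOn (C.closedLoop k) z 0 →
      C.homNorm (z 0) ≤ 1 → ∀ t ≥ (m + 1 : ℝ), C.homNorm (z t) ≤ 1 / 2 := by
    by_contra! hcon
    choose k hk z hz hz0 t ht hzt using hcon
    have hk₁ : ∀ m, k₁ < k m := fun m => lt_of_le_of_lt (le_max_left _ _) (hk m)
    have hkt : Tendsto k (hyperfilter ℕ) atTop :=
      (tendsto_atTop_mono (fun m => (lt_of_le_of_lt (le_max_right _ _) (hk m)).le)
        tendsto_natCast_atTop_atTop).mono_left Nat.hyperfilter_le_atTop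
    have hb : LocallyBoundedAlong (hyperfilter ℕ) z :=
      C.locallyBoundedAlong_of_homNorm_le fun S => ⟨B * 1, Eventually.of_forall fun m u hu =>
        hbd (k m) (hk₁ m) _ (hz m) 1 one_pos (hz0 m) u hu.1⟩
    have hc : 0 < 1 / (2 * B) := by positivity
    refine not_persistent_of_tracks hs (fun m => (hz m).solvesAlong) hb
      (tracksAlong_of_highGain C.f_cont C.ybar_cont C.σ_cont C.σ_pos
        C.σ_neg (fun m => (hz m).solvesAlong) hkt (fun m t ht => (hz m).hasDerivWithinAt_snd ht) hb)
      hc fun m u hu => ?_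
    by_contra! hlt
    have := hbd (k m) (hk₁ m) _ ((hz m).comp_const_add hu.1) _ hc (by simpa using hlt.le)
      (t m - u) (by linarith [hu.2, ht m])
    rw [add_sub_cancel, show B * (1 / (2 * B)) = 1 / 2 by field_simp] at this
    linarith [hzt m]
  obtain ⟨m, hm⟩ := hunit
  refine ⟨max k₁ m, lt_max_of_lt_left hk₁, B, hB, m + 1, by positivity,
    fun k hk z hz a ha h0 =>
      ⟨hbd k (lt_of_le_of_lt (le_max_left _ _) hk) z hz a ha h0, fun t ht => ?_⟩⟩
  have hak : 0 < a ^ (-C.κ) := Real.rpow_pos_of_pos ha _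
  have := hm k hk _ (hz.rescale (inv_pos.2 ha)) (homNorm_rescale_inv_zero_le ha h0)
    (t / a ^ (-C.κ)) (by rwa [ge_iff_le, le_div_iff₀ hak])
  rw [homNorm_rescale_inv ha, mul_div_cancel₀ t hak.ne', inv_mul_le_iff₀ ha] at this
  linarith

/-- Iterating the contraction estimate. -/
theorem homNorm_le_of_contraction {k T : ℝ} (hT : 0 < T)
    (hc : ∀ z, IsSolOn (C.closedLoop k) z 0 → ∀ a > 0, C.homNorm (z 0) ≤ a →
      ∀ t ≥ T * a ^ (-C.κ), C.homNorm (z t) ≤ a / 2)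
    {z : ℝ → (Fin n → ℝ) × ℝ} (hz : IsSolOn (C.closedLoop k) z 0) {a : ℝ} (ha : 0 < a)
    (h0 : C.homNorm (z 0) ≤ a) (j : ℕ) {t : ℝ}
    (ht : T * a ^ (-C.κ) * ∑ i ∈ Finset.range (j + 1), ((2 : ℝ) ^ C.κ) ^ i ≤ t) :
    C.homNorm (z t) ≤ a / 2 ^ (j + 1) := by
  induction j generalizing t with
  | zero => simpa using hc z hz a ha h0 t (by simpa using ht)
  | succ j ih =>
    set S := T * a ^ (-C.κ) * ∑ i ∈ Finset.range (j + 1), ((2 : ℝ) ^ C.κ) ^ i with hS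
    have hS0 : 0 ≤ S := by
      have : 0 < a ^ (-C.κ) := Real.rpow_pos_of_pos ha _
      positivity
    have hpow : (a / 2 ^ (j + 1)) ^ (-C.κ) = a ^ (-C.κ) * ((2 : ℝ) ^ C.κ) ^ (j + 1) := by
      rw [Real.div_rpow ha.le (by positivity), Real.rpow_neg (by positivity : (0:ℝ) ≤ 2 ^ (j + 1)),
        div_inv_eq_mul, Real.rpow_pow_comm zero_le_two]
    have := hc _ (hz.comp_const_add hS0) (a / 2 ^ (j + 1)) (by positivity)
      (by simpa using ih le_rfl) (t - S) (by
        rw [Finset.sum_range_succ, mul_add] at ht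
        rw [hpow]
        linarith)
    rw [add_sub_cancel] at this
    rwa [pow_succ _ (j + 1), ← div_div]

theorem asympStable_of_contraction {k B T : ℝ} (hB : 1 ≤ B) (hT : 0 < T)
    (hc : ∀ z, IsSolOn (C.closedLoop k) z 0 → ∀ a > 0, C.homNorm (z 0) ≤ a →
      (∀ t ≥ 0, C.homNorm (z t) ≤ B * a) ∧ ∀ t ≥ T * a ^ (-C.κ), C.homNorm (z t) ≤ a / 2) :
    AsympStable (C.closedLoop k) := by
  refine ⟨fun ε hε => ?_, 1, one_pos, fun z hz _ => ?_⟩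
  · obtain ⟨a, ha, haε⟩ := C.exists_homNorm_bound_norm_lt hε
    obtain ⟨η, hη, hηa⟩ := C.exists_norm_bound_homNorm_lt (show 0 < a / B by positivity)
    refine ⟨η, hη, fun z hz h0 t ht => haε _ ?_⟩
    simpa [mul_div_cancel₀ a (show B ≠ 0 by positivity)] using
      (hc z hz (a / B) (by positivity) (hηa _ h0).le).1 t ht
  · set a := C.homNorm (z 0) + 1
    have ha : 0 < a := by have := C.homNorm_nonneg (z 0); positivity
    rw [Metric.tendsto_nhds]
    intro ε hε
    obtain ⟨c, hc0, hcε⟩ := C.exists_homNorm_bound_norm_lt hε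
    obtain ⟨j, hj⟩ := exists_pow_lt_of_lt_one (show 0 < c / a by positivity)
      (one_half_lt_one (α := ℝ))
    filter_upwards [eventually_ge_atTop
      (T * a ^ (-C.κ) * ∑ i ∈ Finset.range (j + 1), ((2 : ℝ) ^ C.κ) ^ i)] with t ht
    have h1 := homNorm_le_of_contraction hT (fun z hz a ha h0 => (hc z hz a ha h0).2) hz ha
      (le_add_of_nonneg_right zero_le_one) j ht
    have h2 : a / 2 ^ (j + 1) ≤ c := by
      rw [lt_div_iff₀ ha, one_div, inv_pow] at hj
      calc a / 2 ^ (j + 1) ≤ a / 2 ^ j := by gcongr <;> simp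
        _ ≤ c := by rw [div_eq_inv_mul]; exact hj.le
    simpa using hcε _ (h1.trans h2)

theorem smallTimeStable_of_contraction (hκ : C.κ < 0) {k B T : ℝ} (hB : 1 ≤ B) (hT : 0 < T)
    (hc : ∀ z, IsSolOn (C.closedLoop k) z 0 → ∀ a > 0, C.homNorm (z 0) ≤ a →
      (∀ t ≥ 0, C.homNorm (z t) ≤ B * a) ∧ ∀ t ≥ T * a ^ (-C.κ), C.homNorm (z t) ≤ a / 2) :
    SmallTimeStable (C.closedLoop k) := by
  intro ε hε
  have hq : (2 : ℝ) ^ C.κ < 1 := Real.rpow_lt_one_of_one_lt_of_neg one_lt_two hκ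
  have hq0 : (0 : ℝ) ≤ 2 ^ C.κ := by positivity
  obtain ⟨η₁, hη₁, hst⟩ := (asympStable_of_contraction hB hT hc).1 ε hε
  have hlim : Tendsto (fun a : ℝ => T * a ^ (-C.κ) * (1 - (2 : ℝ) ^ C.κ)⁻¹) (𝓝[>] 0) (𝓝 0) := by
    have h : Continuous fun a : ℝ => T * a ^ (-C.κ) * (1 - (2 : ℝ) ^ C.κ)⁻¹ :=
      (continuous_const.mul (Real.continuous_rpow_const (by linarith))).mul continuous_const
    have := (h.tendsto 0).mono_left (nhdsWithin_le_nhds (s := Ioi 0))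
    rwa [Real.zero_rpow (by linarith), mul_zero, zero_mul] at this
  obtain ⟨a, haε, ha⟩ := ((hlim.eventually_le_const hε).and self_mem_nhdsWithin).exists
  have ha : 0 < a := ha
  obtain ⟨η₂, hη₂, hηa⟩ := C.exists_norm_bound_homNorm_lt ha
  refine ⟨min η₁ η₂, lt_min hη₁ hη₂, fun z hz h0 =>
    ⟨C.eq_zero_of_homNorm_le ?_, hst z hz (h0.trans_le (min_le_left _ _))⟩⟩
  have hak : 0 < a ^ (-C.κ) := Real.rpow_pos_of_pos ha _
  have hj : ∀ j : ℕ, C.homNorm (z ε) ≤ a * (1 / 2) ^ (j + 1) := fun j => by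
    have := homNorm_le_of_contraction hT (fun z hz a ha h0 => (hc z hz a ha h0).2) hz ha
      (hηa _ (h0.trans_le (min_le_right _ _))).le j (t := ε) (by
        refine le_trans ?_ haε
        gcongr
        rw [← tsum_geometric_of_lt_one hq0 hq]
        exact (summable_geometric_of_lt_one hq0 hq).sum_le_tsum _ fun i _ => by positivity)
    rwa [one_div, inv_pow, ← div_eq_mul_inv]
  have hpow : Tendsto (fun j : ℕ => a * (1 / 2 : ℝ) ^ (j + 1)) atTop (𝓝 (a * 0)) :=
    ((tendsto_pow_atTop_nhds_zero_of_lt_one (by norm_num) (by norm_num)).comp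
      (tendsto_add_atTop_nat 1)).const_mul a
  rw [mul_zero] at hpow
  exact ge_of_tendsto' hpow hj

end HomCascade

/-- Backstepping/desingularization theorem for homogeneous cascaded systems:
`ẋ = f(x,y), ẏ = v` with the explicit feedback
`v(x,y) = -k ⌊⌊y⌉^l - ⌊ȳ(x)⌉^l⌉^{(κ+r_{n+1})/(l r_{n+1})}`. -/
theorem stmt3 {n : ℕ} (r : Fin n → ℝ) (rn : ℝ) (hr : ∀ i, 0 < r i) (hrn : 0 < rn)
    (κ : ℝ) (f : (Fin n → ℝ) → ℝ → (Fin n → ℝ))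
    (hf : Continuous fun p : (Fin n → ℝ) × ℝ => f p.1 p.2)
    (hhom : ∀ i, ∀ lam > (0:ℝ), ∀ x y,
      f (dil r lam x) (lam ^ rn * y) i = lam ^ (r i + κ) * f x y i)
    (hκ : ∀ i, 0 < κ + r i) (hκn : 0 < κ + rn)
    (ybar : (Fin n → ℝ) → ℝ) (hybar : Continuous ybar)
    (l : ℝ) (hl : 0 < l) (hl2 : ∀ i, r i / rn < l + 1)
    (hybarhom : ∀ lam > (0:ℝ), ∀ x, ybar (dil r lam x) = lam ^ rn * ybar x)
    (hstab : AsympStable fun x => f x (ybar x))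
    (hC1 : ContDiff ℝ 1 fun x => spow (ybar x) l) :
    ∃ k₀ > (0:ℝ), ∀ k > k₀,
      AsympStable (fun p : (Fin n → ℝ) × ℝ =>
        (f p.1 p.2, -k * spow (spow p.2 l - spow (ybar p.1) l) ((κ + rn) / (l * rn)))) ∧
      (κ < 0 → SmallTimeStable (fun p : (Fin n → ℝ) × ℝ =>
        (f p.1 p.2, -k * spow (spow p.2 l - spow (ybar p.1) l) ((κ + rn) / (l * rn))))) := by
  have hp : 0 < (κ + rn) / (l * rn) := by positivity
  let C : HomCascade n :=
    { r := r, rn := rn, κ := κ, f := f, ybar := ybar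
      σ := fun x y => spow (spow y l - spow (ybar x) l) ((κ + rn) / (l * rn))
      r_pos := hr, rn_pos := hrn, f_cont := hf, f_hom := hhom
      ybar_cont := hybar, ybar_hom := hybarhom
      σ_cont := (continuous_spow hp).comp (((continuous_spow hl).comp continuous_snd).sub
        ((continuous_spow hl).comp (hybar.comp continuous_fst)))
      σ_pos := fun x y h => by
        have h1 := strictMono_spow hp (sub_pos.2 (strictMono_spow hl h))
        simpa only [spow_zero_left] using h1
      σ_neg := fun x y h => by
        have h1 := strictMono_spow hp (sub_neg.2 (strictMono_spow hl h))
        simpa only [spow_zero_left] using h1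
      σ_hom := fun lam hlam x y => by
        have hpos : 0 < lam ^ rn := Real.rpow_pos_of_pos hlam rn
        rw [hybarhom lam hlam, spow_mul hpos, spow_mul hpos, ← mul_sub,
          spow_mul (Real.rpow_pos_of_pos hpos l), ← Real.rpow_mul hlam.le,
          ← Real.rpow_mul hlam.le]
        congr 2
        field_simp
        ring }
  obtain ⟨k₀, hk₀, B, hB, T, hT, hc⟩ := HomCascade.exists_contraction (C := C) hstab
  exact ⟨k₀, hk₀, fun k hk => ⟨HomCascade.asympStable_of_contraction hB hT (hc k hk),
    fun hneg => HomCascade.smallTimeStable_of_contraction (C := C) hneg hB hT (hc k hk)⟩⟩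
end
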